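/- For every α > 0 and k, s, t ∈ ℕ there exists C = C(α, k, s, t) > 0 such that the following holds for every d ∈ [k−1] and every sufficiently large n. Let F be a k-graph on s vertices with t edges, and let H = {H_1, …, H_{tn}} be a k-graph system on sn vertices with δ_d(H_i) ≥ (δ_{F,d}^T + α)·binom(sn−d, k−d) for each i ∈ [tn]. Then there is a (C/n)-vertex-spread probability distribution on the embeddings of F*-factors into the auxiliary (k+1)-graph 𝓗, i.e., on embeddings into 𝓗 of the (k+1)-graph consisting of n pairwise vertex-disjoint copies of the expansion F*. -/

import Mathlib

/-- A transversal `F`-factor of the `k`-graph system `Hs` on `s*n` vertices. -/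
def IsTransversalFFactor {s t n : ℕ} (F : Finset (Finset (Fin s)))
    (Hs : Fin (t * n) → Finset (Finset (Fin (s * n)))) : Prop :=
  ∃ φ : Fin n → Fin s → Fin (s * n),
    (∀ j, Function.Injective (φ j)) ∧
    (∀ j j' : Fin n, j ≠ j' → ∀ a b, φ j a ≠ φ j' b) ∧
    ∃ c : Fin n × {e // e ∈ F} → Fin (t * n),
      Function.Bijective c ∧
      ∀ (j : Fin n) (e : {e // e ∈ F}), Finset.image (φ j) e.1 ∈ Hs (c (j, e))

/-- The Dirac threshold `δ_{F,d}^T` for transversal `F`-factors in `k`-graph systems. -/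
noncomputable def transversalDiracThreshold (k s t d : ℕ) (F : Finset (Finset (Fin s))) : ℝ :=
  sInf {δ : ℝ | 0 < δ ∧ ∀ α : ℝ, 0 < α → ∃ n₀ : ℕ, ∀ n : ℕ, n₀ ≤ n →
    ∀ Hs : Fin (t * n) → Finset (Finset (Fin (s * n))),
      (∀ i, ∀ e ∈ Hs i, e.card = k) →
      (∀ i (D : Finset (Fin (s * n))), D.card = d →
        (δ + α) * ((s * n - d).choose (k - d) : ℝ) ≤
          (((Hs i).filter fun e => D ⊆ e).card : ℝ)) →
      IsTransversalFFactor F Hs}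

open Classical in
/-- A probability distribution `μ` on functions `V → W` is `q`-vertex-spread if for any
two sequences of distinct vertices `x : Fin s → V` and `y : Fin s → W`, the probability
that `f (x i) = y i` for all `i` is at most `q ^ s`. -/
def IsVertexSpread {V W : Type*} [Fintype V] [Fintype W] [DecidableEq V] [DecidableEq W]
    (q : ℝ) (μ : (V → W) → ℝ) : Prop :=
  ∀ (s : ℕ) (x : Fin s → V) (y : Fin s → W),
    Function.Injective x → Function.Injective y →
    ∑ f ∈ Finset.univ.filter (fun f : V → W => ∀ i, f (x i) = y i), μ f ≤ q ^ s

/-- `φ` is an embedding, into the auxiliary `(k+1)`-graph `𝓗` of the system `Hs`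
(whose vertices are `Fin (s*n) ⊕ Fin (t*n)` and whose edges are the edges of each `Hs i`
extended by the color `i`), of the `(k+1)`-graph consisting of `n` pairwise vertex-disjoint
copies of the expansion `F*` of `F`. Here the edges of `F` are enumerated by
`f : Fin t → Finset (Fin s)`, and the copy of `F*` with index `m : Fin n` has,
for each `j : Fin t`, the edge `((f j).image Sum.inl ∪ {Sum.inr j}) × {m}`. -/
def IsExpansionFactorEmbedding {s t n : ℕ} (f : Fin t → Finset (Fin s))
    (Hs : Fin (t * n) → Finset (Finset (Fin (s * n))))
    (φ : (Fin s ⊕ Fin t) × Fin n → Fin (s * n) ⊕ Fin (t * n)) : Prop :=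
  Function.Injective φ ∧
  ∀ (m : Fin n) (j : Fin t), ∃ i : Fin (t * n), ∃ e ∈ Hs i,
    ((f j).image fun v => φ (Sum.inl v, m)) ∪ {φ (Sum.inr j, m)} =
      e.image Sum.inl ∪ {Sum.inr i}

section LocalLemma

open Finset Equiv
open scoped Classical

variable {G Y : Type*} [Group G] [Fintype G] [Fintype Y]

/-- The element `g` acts on the first coordinates of the pairs in `A` as prescribed by `A`. -/
def Realizes (ρ : G →* Perm Y) (A : Finset (Y × Y)) (g : G) : Prop :=
  ∀ p ∈ A, ρ g p.1 = p.2

/-- The elements of `G` realizing the partial map `A`. -/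
noncomputable def realizers (ρ : G →* Perm Y) (A : Finset (Y × Y)) : Finset G :=
  univ.filter (Realizes ρ A)

/-- The elements of `G` realizing none of the partial maps in `𝓑`. -/
noncomputable def avoiders (ρ : G →* Perm Y) (𝓑 : Finset (Finset (Y × Y))) : Finset G :=
  univ.filter fun g => ∀ B ∈ 𝓑, ¬ Realizes ρ B g

/-- Two partial maps conflict if their domains or their ranges intersect. -/
def Conflict (A B : Finset (Y × Y)) : Prop :=
  ∃ p ∈ A, ∃ q ∈ B, p.1 = q.1 ∨ p.2 = q.2

/-- The image of `ρ` contains all transpositions within its orbits. -/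
def HasSwaps (ρ : G →* Perm Y) : Prop :=
  ∀ g y, ∃ h, ρ h = swap y (ρ g y)

variable {ρ : G →* Perm Y}

omit [Fintype G] [Fintype Y] in
lemma HasSwaps.exists_realign (hρ : HasSwaps ρ) (a b : G) (X : Finset Y) :
    ∃ h, (∀ x ∈ X, ρ h (ρ a x) = ρ b x) ∧
      ∀ z, (∀ x ∈ X, z ≠ ρ a x ∧ z ≠ ρ b x) → ρ h z = z := by
  induction X using Finset.induction_on with
  | empty => exact ⟨1, by simp, by simp⟩
  | insert x X hx ih =>
    obtain ⟨h, h₁, h₂⟩ := ih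
    obtain ⟨u, hu⟩ := hρ (b * a⁻¹ * h⁻¹) (ρ h (ρ a x))
    have hu' : ρ u = swap (ρ h (ρ a x)) (ρ b x) := by
      rw [hu]; simp [map_mul, map_inv]
    refine ⟨u * h, ?_, ?_⟩
    · intro z hz
      rw [mem_insert] at hz
      rw [map_mul, hu', Perm.mul_apply]
      by_cases hzx : z = x
      · subst hzx; simp
      · have hzX := hz.resolve_left hzx
        apply (swap_apply_of_ne_of_ne _ _).trans (h₁ z hzX)
        · simpa using hzx
        · rw [h₁ z hzX]; simpa using hzx
    · intro z hz
      have hzz := h₂ z fun w hw => hz w (mem_insert_of_mem hw)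
      have hzx := hz x (mem_insert_self _ _)
      rw [map_mul, hu', Perm.mul_apply, hzz]
      apply swap_apply_of_ne_of_ne _ hzx.2
      intro hc
      exact hzx.1 ((ρ h).injective (hzz.trans hc))

/-- The lopsided dependency inequality for random elements of a group of permutations. -/
lemma HasSwaps.card_realizers_inter_avoiders (hρ : HasSwaps ρ) (A : Finset (Y × Y))
    (𝓑 : Finset (Finset (Y × Y))) (h𝓑 : ∀ B ∈ 𝓑, ¬ Conflict A B) :
    #(realizers ρ A ∩ avoiders ρ 𝓑) * Fintype.card G ≤ #(realizers ρ A) * #(avoiders ρ 𝓑) := by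
  by_cases hA : ∃ g₀, Realizes ρ A g₀
  swap
  · have : realizers ρ A = ∅ := by
      apply filter_eq_empty_iff.2
      push Not at hA
      exact fun g _ => hA g
    simp [this]
  obtain ⟨g₀, hg₀⟩ := hA
  have step (w : G) : #(realizers ρ A ∩ avoiders ρ 𝓑) ≤
      #{g ∈ avoiders ρ 𝓑 | ∀ p ∈ A, ρ g p.1 = ρ w p.1} := by
    obtain ⟨h, h₁, h₂⟩ := hρ.exists_realign g₀ w (A.image Prod.fst)
    refine card_le_card_of_injOn (fun g => h * g) ?_ (mul_right_injective h).injOn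
    intro g hg
    simp only [realizers, avoiders, coe_inter, coe_filter, mem_univ, true_and,
      Set.mem_inter_iff, Set.mem_ofPred_eq] at hg
    obtain ⟨hgA, hgB⟩ := hg
    have key : ∀ p ∈ A, ρ (h * g) p.1 = ρ w p.1 := by
      intro p hp
      rw [map_mul, Perm.mul_apply, hgA p hp, ← hg₀ p hp]
      exact h₁ _ (mem_image_of_mem _ hp)
    simp only [avoiders, coe_filter, mem_filter, mem_univ, true_and, Set.mem_ofPred_eq]
    refine ⟨fun B hB hBg => hgB B hB fun q hq => ?_, key⟩
    have hq' := hBg q hq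
    have hfix : ρ h q.2 = q.2 := by
      apply h₂
      simp only [mem_image, forall_exists_index, and_imp]
      rintro x p hp rfl
      constructor
      · rw [hg₀ p hp]
        intro hc
        exact h𝓑 B hB ⟨p, hp, q, hq, Or.inr hc.symm⟩
      · rw [← key p hp, ← hq']
        intro hc
        exact h𝓑 B hB ⟨p, hp, q, hq, Or.inl ((ρ (h * g)).injective hc).symm⟩
    rw [map_mul, Perm.mul_apply] at hq'
    exact (ρ h).injective (hq'.trans hfix.symm)
  have count (g : G) : #{w | ∀ p ∈ A, ρ g p.1 = ρ w p.1} ≤ #(realizers ρ A) := by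
    refine card_le_card_of_injOn (fun w => g₀ * g⁻¹ * w) ?_ (mul_right_injective _).injOn
    intro w hw
    simp only [coe_filter, mem_univ, true_and, Set.mem_ofPred_eq] at hw
    simp only [realizers, coe_filter, mem_univ, true_and, Set.mem_ofPred_eq]
    intro p hp
    simp [map_mul, ← hw p hp, hg₀ p hp]
  calc #(realizers ρ A ∩ avoiders ρ 𝓑) * Fintype.card G
      = ∑ _w : G, #(realizers ρ A ∩ avoiders ρ 𝓑) := by simp [mul_comm]
    _ ≤ ∑ w : G, #{g ∈ avoiders ρ 𝓑 | ∀ p ∈ A, ρ g p.1 = ρ w p.1} :=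
        sum_le_sum fun w _ => step w
    _ = ∑ g ∈ avoiders ρ 𝓑, #{w | ∀ p ∈ A, ρ g p.1 = ρ w p.1} := by
        simp only [card_filter]
        exact sum_comm
    _ ≤ ∑ g ∈ avoiders ρ 𝓑, #(realizers ρ A) := sum_le_sum fun g _ => count g
    _ = _ := by simp [mul_comm]

/-- If realizing a partial map in `𝓐` is at most twice as likely among the avoiders of `𝓑` as
overall, then additionally avoiding a light part of `𝓐` at most halves the number of avoiders. -/
lemma card_avoiders_le_two_mul {𝓐 𝓑 𝓡 : Finset (Finset (Y × Y))} (h𝓡 : 𝓡 ⊆ 𝓐)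
    (h : ∀ B ∈ 𝓐, #(realizers ρ B ∩ avoiders ρ 𝓑) * Fintype.card G ≤
      2 * (#(realizers ρ B) * #(avoiders ρ 𝓑)))
    (hw : 4 * ∑ B ∈ 𝓡, #(realizers ρ B) ≤ Fintype.card G) :
    #(avoiders ρ 𝓑) ≤ 2 * #(avoiders ρ (𝓑 ∪ 𝓡)) := by
  have hsub : avoiders ρ 𝓑 ⊆
      avoiders ρ (𝓑 ∪ 𝓡) ∪ 𝓡.biUnion fun B => realizers ρ B ∩ avoiders ρ 𝓑 := by
    intro g hg
    simp only [mem_union, mem_biUnion, mem_inter]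
    by_cases hgR : ∃ B ∈ 𝓡, Realizes ρ B g
    · obtain ⟨B, hB, hBg⟩ := hgR
      exact Or.inr ⟨B, hB, by simpa [realizers] using hBg, hg⟩
    · left
      push Not at hgR
      simp only [avoiders, mem_filter, mem_univ, true_and, mem_union] at hg ⊢
      rintro B (hB | hB)
      exacts [hg B hB, hgR B hB]
  have h₁ : #(avoiders ρ 𝓑) ≤
      #(avoiders ρ (𝓑 ∪ 𝓡)) + ∑ B ∈ 𝓡, #(realizers ρ B ∩ avoiders ρ 𝓑) :=
    (card_le_card hsub).trans ((card_union_le _ _).trans (by gcongr; exact card_biUnion_le))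
  have h₂ : (∑ B ∈ 𝓡, #(realizers ρ B ∩ avoiders ρ 𝓑)) * Fintype.card G ≤
      2 * ((∑ B ∈ 𝓡, #(realizers ρ B)) * #(avoiders ρ 𝓑)) := by
    rw [sum_mul, sum_mul, mul_sum]
    exact sum_le_sum fun B hB => h B (h𝓡 hB)
  have hG : 0 < Fintype.card G := Fintype.card_pos
  have h₃ : 2 * ((∑ B ∈ 𝓡, #(realizers ρ B ∩ avoiders ρ 𝓑))) * Fintype.card G ≤
      #(avoiders ρ 𝓑) * Fintype.card G := by
    have := Nat.mul_le_mul_right #(avoiders ρ 𝓑) hw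
    nlinarith
  have h₄ := Nat.le_of_mul_le_mul_right h₃ hG
  omega

/-- The total weight of the partial maps in `𝓑` that conflict with `A`. -/
noncomputable def conflictWeight (ρ : G →* Perm Y) (𝓑 : Finset (Finset (Y × Y)))
    (A : Finset (Y × Y)) : ℕ :=
  ∑ B ∈ 𝓑 with Conflict A B, #(realizers ρ B)

/-- The lopsided local lemma for random elements of a group of permutations. -/
lemma HasSwaps.card_realizers_inter_avoiders_le_two_mul (hρ : HasSwaps ρ)
    {𝓐 : Finset (Finset (Y × Y))} (h𝓐 : ∀ B ∈ 𝓐, 4 * conflictWeight ρ 𝓐 B ≤ Fintype.card G)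
    (𝓑 : Finset (Finset (Y × Y))) (h𝓑 : 𝓑 ⊆ 𝓐) (B : Finset (Y × Y)) (hB : B ∈ 𝓐) :
    #(realizers ρ B ∩ avoiders ρ 𝓑) * Fintype.card G ≤
      2 * (#(realizers ρ B) * #(avoiders ρ 𝓑)) := by
  induction 𝓑 using Finset.strongInduction generalizing B with
  | H 𝓑 ih =>
    set 𝓡 := 𝓑.filter (Conflict B) with h𝓡
    set 𝓑' := 𝓑.filter (fun B' => ¬ Conflict B B') with h𝓑'
    have hun : 𝓑' ∪ 𝓡 = 𝓑 := by rw [union_comm]; exact filter_union_filter_not_eq _ _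
    have hloc := hρ.card_realizers_inter_avoiders B 𝓑' fun B' hB' => (mem_filter.1 hB').2
    have hmono : #(realizers ρ B ∩ avoiders ρ 𝓑) ≤ #(realizers ρ B ∩ avoiders ρ 𝓑') := by
      apply card_le_card
      apply inter_subset_inter_left
      intro g hg
      simp only [avoiders, mem_filter, mem_univ, true_and] at hg ⊢
      exact fun B' hB' => hg B' (mem_of_mem_filter _ hB')
    have hhalf : #(avoiders ρ 𝓑') ≤ 2 * #(avoiders ρ 𝓑) := by
      by_cases hne : 𝓡 = ∅
      · rw [hne, union_empty] at hun
        rw [hun]; omega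
      · have hss : 𝓑' ⊂ 𝓑 := by
          refine ⟨filter_subset _ _, fun hle => hne ?_⟩
          rw [h𝓡, filter_eq_empty_iff]
          exact fun B' hB' => (mem_filter.1 (hle hB')).2
        have := card_avoiders_le_two_mul (ρ := ρ) (𝓑 := 𝓑') (𝓡 := 𝓡)
          ((filter_subset _ _).trans h𝓑)
          (fun B' hB' => ih 𝓑' hss (hss.1.trans h𝓑) B' hB') ?_
        · rwa [hun] at this
        · refine le_trans ?_ (h𝓐 B hB)
          unfold conflictWeight
          gcongr
          exact filter_subset_filter _ h𝓑
    calc _ ≤ #(realizers ρ B ∩ avoiders ρ 𝓑') * Fintype.card G := by gcongr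
      _ ≤ #(realizers ρ B) * #(avoiders ρ 𝓑') := hloc
      _ ≤ #(realizers ρ B) * (2 * #(avoiders ρ 𝓑)) := by gcongr
      _ = _ := by ring

lemma HasSwaps.card_avoiders_pos (hρ : HasSwaps ρ)
    {𝓐 : Finset (Finset (Y × Y))} (h𝓐 : ∀ B ∈ 𝓐, 4 * conflictWeight ρ 𝓐 B ≤ Fintype.card G)
    (hne : ∀ B ∈ 𝓐, B.Nonempty) (𝓑 : Finset (Finset (Y × Y))) (h𝓑 : 𝓑 ⊆ 𝓐) :
    0 < #(avoiders ρ 𝓑) := by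
  induction 𝓑 using Finset.induction_on with
  | empty => simp [avoiders, Fintype.card_pos]
  | insert B 𝓑 hB ih =>
    have h𝓑' := (subset_insert B 𝓑).trans h𝓑
    have hBA := h𝓑 (mem_insert_self B 𝓑)
    have := card_avoiders_le_two_mul (ρ := ρ) (𝓐 := 𝓐) (𝓑 := 𝓑) (𝓡 := {B})
      (by simpa using hBA)
      (fun B' hB' => hρ.card_realizers_inter_avoiders_le_two_mul h𝓐 𝓑 h𝓑' B' hB') ?_
    · rw [union_comm, ← insert_eq] at this
      have := ih h𝓑'
      omega
    · refine le_trans ?_ (h𝓐 B hBA)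
      rw [sum_singleton]
      unfold conflictWeight
      gcongr
      obtain ⟨p, hp⟩ := hne B hBA
      exact single_le_sum (f := fun B => #(realizers ρ B)) (fun _ _ => Nat.zero_le _)
        (mem_filter.2 ⟨hBA, p, hp, p, hp, Or.inl rfl⟩)

/-- Removing from `𝓐` the partial maps conflicting with `A` increases the number of avoiders by
a factor of at most `2 ^ #A`. -/
lemma HasSwaps.card_avoiders_not_conflict_le (hρ : HasSwaps ρ)
    {𝓐 : Finset (Finset (Y × Y))} (h𝓐 : ∀ B ∈ 𝓐, 4 * conflictWeight ρ 𝓐 B ≤ Fintype.card G)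
    (h𝓐' : ∀ p, 4 * conflictWeight ρ 𝓐 {p} ≤ Fintype.card G) (A : Finset (Y × Y)) :
    #(avoiders ρ (𝓐.filter fun B => ¬ Conflict A B)) ≤ 2 ^ #A * #(avoiders ρ 𝓐) := by
  induction A using Finset.induction_on with
  | empty => simp [Conflict]
  | insert p A hp ih =>
    have hun : (𝓐.filter fun B => ¬ Conflict (insert p A) B) ∪
        (𝓐.filter fun B => ¬ Conflict A B ∧ Conflict {p} B) =
          𝓐.filter fun B => ¬ Conflict A B := by
      ext B
      have hc : Conflict (insert p A) B ↔ Conflict {p} B ∨ Conflict A B := by simp [Conflict]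
      simp only [mem_union, mem_filter, hc]
      tauto
    have := card_avoiders_le_two_mul (ρ := ρ) (𝓐 := 𝓐)
      (𝓑 := 𝓐.filter fun B => ¬ Conflict (insert p A) B)
      (𝓡 := 𝓐.filter fun B => ¬ Conflict A B ∧ Conflict {p} B) (filter_subset _ _)
      (hρ.card_realizers_inter_avoiders_le_two_mul h𝓐 _ (filter_subset _ _)) ?_
    · rw [hun] at this
      rw [card_insert_of_notMem hp, pow_succ]
      nlinarith
    · refine le_trans ?_ (h𝓐' p)
      unfold conflictWeight
      gcongr
      tauto

lemma HasSwaps.card_realizers_inter_avoiders_le (hρ : HasSwaps ρ)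
    {𝓐 : Finset (Finset (Y × Y))} (h𝓐 : ∀ B ∈ 𝓐, 4 * conflictWeight ρ 𝓐 B ≤ Fintype.card G)
    (h𝓐' : ∀ p, 4 * conflictWeight ρ 𝓐 {p} ≤ Fintype.card G) (A : Finset (Y × Y)) :
    #(realizers ρ A ∩ avoiders ρ 𝓐) * Fintype.card G ≤
      2 ^ #A * #(realizers ρ A) * #(avoiders ρ 𝓐) := by
  have h₁ := hρ.card_realizers_inter_avoiders A (𝓐.filter fun B => ¬ Conflict A B)
    fun B hB => (mem_filter.1 hB).2
  have h₂ := hρ.card_avoiders_not_conflict_le h𝓐 h𝓐' A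
  have hmono : #(realizers ρ A ∩ avoiders ρ 𝓐) ≤
      #(realizers ρ A ∩ avoiders ρ (𝓐.filter fun B => ¬ Conflict A B)) := by
    apply card_le_card
    apply inter_subset_inter_left
    intro g hg
    simp only [avoiders, mem_filter, mem_univ, true_and] at hg ⊢
    exact fun B' hB' => hg B' hB'.1
  calc _ ≤ #(realizers ρ A ∩ avoiders ρ (𝓐.filter fun B => ¬ Conflict A B)) *
        Fintype.card G := by gcongr
    _ ≤ _ := h₁
    _ ≤ #(realizers ρ A) * (2 ^ #A * #(avoiders ρ 𝓐)) := by gcongr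
    _ = _ := by ring

end LocalLemma

section Clusters

open Finset Equiv
open scoped Classical

variable {G Y J : Type*} [Group G] [Fintype G] [Fintype Y] {ρ : G →* Perm Y}

/-- The graph of the permutation `ρ g` restricted to the cluster `j`. -/
noncomputable def clusterGraph (ρ : G →* Perm Y) (cl : Y → J) (g : G) (j : J) :
    Finset (Y × Y) :=
  (univ.filter fun x => cl x = j).image fun x => (x, ρ g x)

omit [Fintype G] in
lemma mem_clusterGraph {cl : Y → J} {g : G} {j : J} {p : Y × Y} :
    p ∈ clusterGraph ρ cl g j ↔ cl p.1 = j ∧ ρ g p.1 = p.2 := by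
  obtain ⟨a, b⟩ := p
  simp only [clusterGraph, mem_image, mem_filter, mem_univ, true_and, Prod.mk.injEq]
  constructor
  · rintro ⟨x, hx, rfl, rfl⟩; exact ⟨hx, rfl⟩
  · rintro ⟨h, rfl⟩; exact ⟨a, h, rfl, rfl⟩

/-- The restrictions to single clusters that are bad. -/
noncomputable def badGraphs (ρ : G →* Perm Y) (cl : Y → J) (bad : J → G → Prop) :
    Finset (Finset (Y × Y)) :=
  ((univ : Finset (G × Y)).filter fun q => bad (cl q.2) q.1).image
    fun q => clusterGraph ρ cl q.1 (cl q.2)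

lemma conflictWeight_singleton_le {cl : Y → J} {bad : J → G → Prop}
    (hloc : ∀ j g h, (∀ x, cl x = j → ρ g x = ρ h x) → bad j g → bad j h) (p : Y × Y) :
    conflictWeight ρ (badGraphs ρ cl bad) {p} ≤
      #{g | bad (cl p.1) g} + #{g | bad (cl ((ρ g)⁻¹ p.2)) g} := by
  have hpt (g : G) : #{B ∈ badGraphs ρ cl bad | Conflict {p} B ∧ Realizes ρ B g} ≤
      (if bad (cl p.1) g then 1 else 0) + (if bad (cl ((ρ g)⁻¹ p.2)) g then 1 else 0) := by
    have hsub : {B ∈ badGraphs ρ cl bad | Conflict {p} B ∧ Realizes ρ B g} ⊆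
        (if bad (cl p.1) g then {clusterGraph ρ cl g (cl p.1)} else ∅) ∪
        (if bad (cl ((ρ g)⁻¹ p.2)) g then {clusterGraph ρ cl g (cl ((ρ g)⁻¹ p.2))} else ∅) := by
      intro B hB
      simp only [badGraphs, mem_filter, mem_image, mem_univ, true_and, Prod.exists] at hB
      obtain ⟨⟨g₀, x₀, hbad, rfl⟩, ⟨p', hp', q, hq, hpq⟩, hreal⟩ := hB
      rw [mem_singleton] at hp'
      subst hp'
      have hagree : ∀ x, cl x = cl x₀ → ρ g₀ x = ρ g x := fun x hx =>
        (hreal (x, ρ g₀ x) (mem_clusterGraph.2 ⟨hx, rfl⟩)).symm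
      have hbad' := hloc _ _ _ hagree hbad
      have hgr : clusterGraph ρ cl g₀ (cl x₀) = clusterGraph ρ cl g (cl x₀) := by
        ext q
        rw [mem_clusterGraph, mem_clusterGraph]
        refine and_congr_right fun h => ?_
        rw [hagree _ h]
      rw [hgr] at hq ⊢
      rw [mem_clusterGraph] at hq
      rcases hpq with h | h
      · rw [h, hq.1, if_pos hbad']
        simp
      · have h' : (ρ g)⁻¹ p'.2 = q.1 := by
          rw [h, ← hq.2]; simp
        rw [h', hq.1, if_pos hbad']
        simp
    refine (card_le_card hsub).trans ((card_union_le _ _).trans ?_)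
    split_ifs <;> simp
  calc conflictWeight ρ (badGraphs ρ cl bad) {p}
      = ∑ g : G, #{B ∈ badGraphs ρ cl bad | Conflict {p} B ∧ Realizes ρ B g} := by
        simp only [conflictWeight, realizers, card_filter]
        rw [sum_comm]
        refine sum_congr rfl fun g _ => ?_
        rw [sum_filter]
        refine sum_congr rfl fun B _ => ?_
        by_cases h : Conflict {p} B <;> simp [h]
    _ ≤ ∑ g : G, ((if bad (cl p.1) g then 1 else 0) +
          (if bad (cl ((ρ g)⁻¹ p.2)) g then 1 else 0)) := sum_le_sum fun g _ => hpt g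
    _ = _ := by rw [sum_add_distrib, card_filter, card_filter]

/-- If every cluster is unlikely to be bad, there is a nonempty set of group elements for which no
cluster is bad and whose uniform distribution is almost as spread as that of the whole group. -/
lemma HasSwaps.exists_no_bad_cluster (hρ : HasSwaps ρ) {cl : Y → J} {bad : J → G → Prop}
    (hloc : ∀ j g h, (∀ x, cl x = j → ρ g x = ρ h x) → bad j g → bad j h) {K : ℕ} (hK₀ : 0 < K)
    (hK : ∀ x, #{y | cl y = cl x} ≤ K)
    (h₁ : ∀ x, 8 * K * #{g | bad (cl x) g} ≤ Fintype.card G)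
    (h₂ : ∀ y, 8 * K * #{g | bad (cl ((ρ g)⁻¹ y)) g} ≤ Fintype.card G) :
    ∃ 𝓖 : Finset G, 𝓖.Nonempty ∧ (∀ g ∈ 𝓖, ∀ x, ¬ bad (cl x) g) ∧
      ∀ A, #(realizers ρ A ∩ 𝓖) * Fintype.card G ≤ 2 ^ #A * #(realizers ρ A) * #𝓖 := by
  have hsingle (p : Y × Y) :
      4 * K * conflictWeight ρ (badGraphs ρ cl bad) {p} ≤ Fintype.card G := by
    have := Nat.mul_le_mul_left (4 * K) (conflictWeight_singleton_le hloc p)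
    have := h₁ p.1
    have := h₂ p.2
    nlinarith
  have hsingle' (p : Y × Y) : 4 * conflictWeight ρ (badGraphs ρ cl bad) {p} ≤ Fintype.card G :=
    le_trans (Nat.mul_le_mul_right _ (by omega)) (hsingle p)
  have hmulti : ∀ B ∈ badGraphs ρ cl bad,
      4 * conflictWeight ρ (badGraphs ρ cl bad) B ≤ Fintype.card G := by
    intro B hB
    have hcard : #B ≤ K := by
      simp only [badGraphs, mem_image, Prod.exists] at hB
      obtain ⟨g, x, -, rfl⟩ := hB
      exact card_image_le.trans (hK x)
    have hle : conflictWeight ρ (badGraphs ρ cl bad) B ≤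
        ∑ p ∈ B, conflictWeight ρ (badGraphs ρ cl bad) {p} := by
      unfold conflictWeight
      simp only [sum_filter]
      rw [sum_comm]
      refine sum_le_sum fun B' _ => ?_
      split_ifs with h
      · obtain ⟨p, hp, hpB'⟩ := h
        have hc : Conflict {p} B' := ⟨p, mem_singleton_self p, hpB'⟩
        refine le_trans ?_ (single_le_sum (fun _ _ => Nat.zero_le _) hp)
        rw [if_pos hc]
      · exact Nat.zero_le _
    have hsum : K * (4 * conflictWeight ρ (badGraphs ρ cl bad) B) ≤ K * Fintype.card G := by
      calc _ ≤ K * (4 * ∑ p ∈ B, conflictWeight ρ (badGraphs ρ cl bad) {p}) := by gcongr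
        _ = ∑ p ∈ B, 4 * K * conflictWeight ρ (badGraphs ρ cl bad) {p} := by
            rw [mul_sum, mul_sum]; exact sum_congr rfl fun _ _ => by ring
        _ ≤ ∑ _p ∈ B, Fintype.card G := sum_le_sum fun p _ => hsingle p
        _ = #B * Fintype.card G := by simp
        _ ≤ _ := by gcongr
    exact Nat.le_of_mul_le_mul_left hsum hK₀
  refine ⟨avoiders ρ (badGraphs ρ cl bad), ?_, ?_, ?_⟩
  · rw [← card_pos]
    refine hρ.card_avoiders_pos hmulti ?_ _ subset_rfl
    intro B hB
    simp only [badGraphs, mem_image, Prod.exists] at hB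
    obtain ⟨g, x, -, rfl⟩ := hB
    exact ⟨(x, ρ g x), mem_clusterGraph.2 ⟨rfl, rfl⟩⟩
  · intro g hg x hbad
    simp only [avoiders, mem_filter, mem_univ, true_and] at hg
    refine hg (clusterGraph ρ cl g (cl x)) ?_ fun p hp => (mem_clusterGraph.1 hp).2
    exact mem_image.2 ⟨(g, x), by simpa using hbad, rfl⟩
  · exact hρ.card_realizers_inter_avoiders_le hmulti hsingle'

end Clusters

section PermPairs

open Finset Equiv
open scoped Classical

variable {V W : Type*} [Fintype V] [Fintype W]

omit [Fintype V] [Fintype W] in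
lemma hasSwaps_sumCongrHom : HasSwaps (Perm.sumCongrHom V W) := by
  rintro ⟨a, b⟩ (v | w)
  · refine ⟨(swap v (a v), 1), ?_⟩
    ext (z | z)
    · simp [Perm.sumCongrHom, swap_apply_def]
    · simp [Perm.sumCongrHom, swap_apply_def]
  · refine ⟨(1, swap w (b w)), ?_⟩
    ext (z | z)
    · simp [Perm.sumCongrHom, swap_apply_def]
    · simp [Perm.sumCongrHom, swap_apply_def]

/-- The permutations with prescribed values on `S`. -/
lemma card_perm_eqOn (S : Finset V) (σ₀ : Perm V) :
    #{σ : Perm V | ∀ v ∈ S, σ v = σ₀ v} = (Fintype.card V - #S).factorial := by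
  have e : {σ : Perm V // ∀ v ∈ S, σ v = σ₀ v} ≃ Perm {v // v ∉ S} := by
    refine Equiv.trans ?_ (Perm.subtypeEquivSubtypePerm (fun v => v ∉ S)).symm
    refine Equiv.subtypeEquiv (Equiv.mulLeft σ₀⁻¹) fun σ => ?_
    simp [Equiv.eq_symm_apply, eq_comm]
  rw [← Fintype.card_subtype, Fintype.card_congr e, Fintype.card_perm,
    Fintype.card_subtype_compl, Fintype.card_coe]

lemma card_perm_eqOn_le (S : Finset V) (f : V → V) :
    #{σ : Perm V | ∀ v ∈ S, σ v = f v} ≤ (Fintype.card V - #S).factorial := by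
  by_cases h : ∃ σ₀ : Perm V, ∀ v ∈ S, σ₀ v = f v
  · obtain ⟨σ₀, h₀⟩ := h
    rw [← card_perm_eqOn S σ₀]
    apply le_of_eq
    congr 1
    ext σ
    simp only [mem_filter, mem_univ, true_and]
    exact forall₂_congr fun v hv => by rw [h₀ v hv]
  · push Not at h
    rw [filter_eq_empty_iff.2 fun σ _ hσ => ?_]
    · simp
    · obtain ⟨v, hv, hne⟩ := h σ
      exact hne (hσ v hv)

lemma pow_mul_factorial_sub_le (N s : ℕ) (h : s ≤ N) :
    (N : ℝ) ^ s * (N - s).factorial ≤ Real.exp 1 ^ s * N.factorial := by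
  induction N generalizing s with
  | zero => simp_all
  | succ N ih =>
    rcases s with - | s
    · simp
    have hs : s ≤ N := by omega
    rcases Nat.eq_zero_or_pos N with rfl | hN
    · obtain rfl : s = 0 := by omega
      simp
    have hN' : (0 : ℝ) < N := by exact_mod_cast hN
    have h1 : ((N : ℝ) + 1) ^ s ≤ Real.exp 1 * (N : ℝ) ^ s := by
      have : (N : ℝ) + 1 ≤ Real.exp (1 / N) * N := by
        have := Real.add_one_le_exp (1 / (N : ℝ))
        have := mul_le_mul_of_nonneg_right this hN'.le
        rwa [add_mul, one_div_mul_cancel hN'.ne', one_mul, add_comm] at this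
      calc ((N : ℝ) + 1) ^ s ≤ (Real.exp (1 / N) * N) ^ s := by gcongr
        _ = Real.exp (s * (1 / N)) * (N : ℝ) ^ s := by rw [mul_pow, ← Real.exp_nat_mul]
        _ ≤ _ := by
          gcongr
          rw [mul_one_div, div_le_one hN']
          exact_mod_cast hs
    rw [Nat.add_sub_add_right, Nat.factorial_succ]
    push_cast
    calc ((N : ℝ) + 1) ^ (s + 1) * (N - s).factorial
        = ((N : ℝ) + 1) * (((N : ℝ) + 1) ^ s * (N - s).factorial) := by ring
      _ ≤ ((N : ℝ) + 1) * (Real.exp 1 * (N : ℝ) ^ s * (N - s).factorial) := by gcongr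
      _ = ((N : ℝ) + 1) * Real.exp 1 * ((N : ℝ) ^ s * (N - s).factorial) := by ring
      _ ≤ ((N : ℝ) + 1) * Real.exp 1 * (Real.exp 1 ^ s * N.factorial) := by
          have := ih s hs
          gcongr
      _ = _ := by ring

/-- The uniform distribution on permutations is spread. -/
lemma card_perm_eqOn_mul_le (S : Finset V) (f : V → V) {n : ℝ} (hn : 0 ≤ n)
    (hnV : n ≤ Fintype.card V) :
    (#{σ : Perm V | ∀ v ∈ S, σ v = f v} : ℝ) * n ^ #S ≤
      Real.exp 1 ^ #S * (Fintype.card V).factorial := by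
  calc _ ≤ ((Fintype.card V - #S).factorial : ℝ) * (Fintype.card V : ℝ) ^ #S := by
        gcongr
        exact card_perm_eqOn_le S f
    _ ≤ _ := by
        rw [mul_comm]
        exact pow_mul_factorial_sub_le _ _ (card_le_univ S)

lemma realizers_sumCongrHom_card_mul_le (A : Finset ((V ⊕ W) × (V ⊕ W)))
    (hA : Set.InjOn Prod.fst (A : Set ((V ⊕ W) × (V ⊕ W)))) {n : ℝ} (hn : 0 ≤ n)
    (hnV : n ≤ Fintype.card V) (hnW : n ≤ Fintype.card W) :
    (#(realizers (Perm.sumCongrHom V W) A) : ℝ) * n ^ #A ≤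
      Real.exp 1 ^ #A * Fintype.card (Perm V × Perm W) := by
  by_cases h : ∃ g₀, Realizes (Perm.sumCongrHom V W) A g₀
  swap
  · have : realizers (Perm.sumCongrHom V W) A = ∅ := by
      apply filter_eq_empty_iff.2
      push Not at h
      exact fun g _ => h g
    rw [this]
    simp only [card_empty, Nat.cast_zero, zero_mul]
    positivity
  obtain ⟨⟨a₀, b₀⟩, h₀⟩ := h
  set D := A.image Prod.fst with hD
  have hcard : #A = #D.toLeft + #D.toRight := by
    rw [card_toLeft_add_card_toRight, hD, card_image_of_injOn hA]
  have hsub : realizers (Perm.sumCongrHom V W) A ⊆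
      ({σ : Perm V | ∀ v ∈ D.toLeft, σ v = a₀ v} : Finset _) ×ˢ
        ({σ : Perm W | ∀ v ∈ D.toRight, σ v = b₀ v} : Finset _) := by
    rintro ⟨a, b⟩ hab
    simp only [realizers, mem_filter, mem_univ, true_and] at hab
    have hboth : ∀ x ∈ D, Perm.sumCongrHom V W (a, b) x = Perm.sumCongrHom V W (a₀, b₀) x := by
      intro x hx
      obtain ⟨p, hp, rfl⟩ := mem_image.1 hx
      rw [hab p hp, h₀ p hp]
    simp only [mem_product, mem_filter, mem_univ, true_and, mem_toLeft, mem_toRight]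
    exact ⟨fun v hv => by simpa [Perm.sumCongrHom] using hboth _ hv,
      fun v hv => by simpa [Perm.sumCongrHom] using hboth _ hv⟩
  have hV := card_perm_eqOn_mul_le D.toLeft a₀ hn hnV
  have hW := card_perm_eqOn_mul_le D.toRight b₀ hn hnW
  calc _ ≤ ((#{σ : Perm V | ∀ v ∈ D.toLeft, σ v = a₀ v} *
        #{σ : Perm W | ∀ v ∈ D.toRight, σ v = b₀ v} : ℕ) : ℝ) * n ^ #A := by
        gcongr
        rw [← card_product]
        exact card_le_card hsub
    _ = (#{σ : Perm V | ∀ v ∈ D.toLeft, σ v = a₀ v} * n ^ #D.toLeft) *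
        (#{σ : Perm W | ∀ v ∈ D.toRight, σ v = b₀ v} * n ^ #D.toRight) := by
        rw [hcard, pow_add]; push_cast; ring
    _ ≤ _ := mul_le_mul hV hW (by positivity) (by positivity)
    _ = _ := by
        rw [hcard, pow_add, Fintype.card_prod, Fintype.card_perm, Fintype.card_perm]
        push_cast; ring

end PermPairs

section Concentration

open Finset

lemma sum_exp_le_of_sum_eq_zero {V : Type*} [Fintype V] (X : V → ℝ) (c : ℝ)
    (hX : ∀ v, |X v| ≤ c) (h₀ : ∑ v, X v = 0) :
    ∑ v, Real.exp (X v) ≤ Fintype.card V * Real.exp (c ^ 2 / 2) := by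
  rcases isEmpty_or_nonempty V with hV | ⟨⟨v₀⟩⟩
  · simp
  rcases ((abs_nonneg _).trans (hX v₀)).eq_or_lt with rfl | hc
  · have : ∀ v, X v = 0 := fun v => abs_nonpos_iff.1 (hX v)
    simp [this]
  calc ∑ v, Real.exp (X v) ≤ ∑ v, (Real.cosh c + X v / c * Real.sinh c) := by
        refine sum_le_sum fun v _ => ?_
        have hv : |X v / c| ≤ 1 := by
          rw [abs_div, abs_of_pos hc, div_le_one hc]; exact hX v
        have := Real.exp_mul_le_cosh_add_mul_sinh hv c
        rwa [div_mul_cancel₀ _ hc.ne'] at this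
    _ = Fintype.card V * Real.cosh c := by
        rw [sum_add_distrib, ← sum_mul, ← sum_div, h₀]; simp
    _ ≤ _ := by gcongr; exact Real.cosh_le_exp_half_sq c

lemma sum_exp_mean_sub_le_fin {V : Type*} [Fintype V] [Nonempty V] (c : ℝ) (q : ℕ)
    (f : (Fin q → V) → ℝ) (hf : ∀ g i v, |f (Function.update g i v) - f g| ≤ c) :
    ∑ g, Real.exp ((∑ g', f g') / (Fintype.card V : ℝ) ^ q - f g) ≤
      (Fintype.card V : ℝ) ^ q * Real.exp (q * (c ^ 2 / 2)) := by
  have hN : (0 : ℝ) < Fintype.card V := by exact_mod_cast Fintype.card_pos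
  induction q with
  | zero => simp
  | succ q ih =>
    have hsplit (F : (Fin (q + 1) → V) → ℝ) :
        ∑ g, F g = ∑ g' : Fin q → V, ∑ v, F (Fin.cons v g') := by
      rw [← (Fin.consEquiv fun _ => V).sum_comp, Fintype.sum_prod_type, sum_comm]
      rfl
    set F : (Fin q → V) → ℝ := fun g' => (∑ v, f (Fin.cons v g')) / Fintype.card V with hF
    have hmean : (∑ g, f g) / (Fintype.card V : ℝ) ^ (q + 1) =
        (∑ g', F g') / (Fintype.card V : ℝ) ^ q := by
      rw [hsplit, hF, ← sum_div, div_div, pow_succ']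
    have hFd : ∀ g i v, |F (Function.update g i v) - F g| ≤ c := by
      intro g i v
      rw [hF]
      simp only
      rw [← sub_div, ← sum_sub_distrib, abs_div, abs_of_pos hN, div_le_iff₀ hN]
      refine (abs_sum_le_sum_abs _ _).trans ?_
      refine (sum_le_card_nsmul _ _ c fun w _ => ?_).trans (by simp [mul_comm])
      rw [Fin.cons_update]
      exact hf _ _ _
    have hin (g' : Fin q → V) : ∑ v, Real.exp (F g' - f (Fin.cons v g')) ≤
        Fintype.card V * Real.exp (c ^ 2 / 2) := by
      apply sum_exp_le_of_sum_eq_zero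
      · intro v
        have : F g' - f (Fin.cons v g') =
            (∑ w, (f (Fin.cons w g') - f (Fin.cons v g'))) / Fintype.card V := by
          rw [hF, sum_sub_distrib, sub_div]
          simp [hN.ne']
        rw [this, abs_div, abs_of_pos hN, div_le_iff₀ hN]
        refine (abs_sum_le_sum_abs _ _).trans ?_
        refine (sum_le_card_nsmul _ _ c fun w _ => ?_).trans (by simp [mul_comm])
        have := hf (Fin.cons v g') 0 w
        rwa [Fin.update_cons_zero] at this
      · rw [sum_sub_distrib, hF]
        simp [mul_div_cancel₀ _ hN.ne']
    rw [hsplit, hmean]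
    calc _ = ∑ g', Real.exp ((∑ g', F g') / (Fintype.card V : ℝ) ^ q - F g') *
          ∑ v, Real.exp (F g' - f (Fin.cons v g')) := by
          refine sum_congr rfl fun g' _ => ?_
          rw [mul_sum]
          refine sum_congr rfl fun v _ => ?_
          rw [← Real.exp_add]; ring_nf
      _ ≤ ∑ g', Real.exp ((∑ g', F g') / (Fintype.card V : ℝ) ^ q - F g') *
          (Fintype.card V * Real.exp (c ^ 2 / 2)) := by gcongr; exact hin _
      _ ≤ ((Fintype.card V : ℝ) ^ q * Real.exp (q * (c ^ 2 / 2))) *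
          (Fintype.card V * Real.exp (c ^ 2 / 2)) := by
          rw [← sum_mul]
          gcongr
          exact ih F hFd
      _ = _ := by
          rw [Nat.cast_succ, add_mul, one_mul, Real.exp_add, pow_succ]; ring

open scoped Classical in
/-- The bounded differences inequality for functions of independent uniform variables. -/
lemma card_le_mean_sub_le {V Q : Type*} [Fintype V] [Nonempty V] [Fintype Q]
    (f : (Q → V) → ℝ) {c : ℝ} (hc : 0 < c)
    (hf : ∀ g i v, |f (Function.update g i v) - f g| ≤ c) {a t : ℝ} (ht : 0 ≤ t)
    (ha : a * (Fintype.card V : ℝ) ^ Fintype.card Q ≤ ∑ g, f g) :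
    (#{g | f g ≤ a - t} : ℝ) ≤ (Fintype.card V : ℝ) ^ Fintype.card Q *
      Real.exp (-(t ^ 2 / (2 * Fintype.card Q * c ^ 2))) := by
  have hN : (0 : ℝ) < Fintype.card V := by exact_mod_cast Fintype.card_pos
  set q := Fintype.card Q with hq
  rcases Nat.eq_zero_or_pos q with hq0 | hq0
  · have := Finset.card_le_univ {g | f g ≤ a - t}
    rw [Fintype.card_fun, ← hq] at this
    simp only [hq0, Nat.cast_zero, mul_zero, zero_mul, div_zero, neg_zero, Real.exp_zero,
      mul_one]
    rw [hq0] at this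
    exact_mod_cast this
  have hqR : (0 : ℝ) < q := by exact_mod_cast hq0
  let e : (Q → V) ≃ (Fin q → V) := Equiv.arrowCongr (Fintype.equivFin Q) (Equiv.refl V)
  set h : ℝ := t / (q * c ^ 2) with hh
  have hh0 : 0 ≤ h := by positivity
  have key := sum_exp_mean_sub_le_fin (h * c) q (fun g => h * f (e.symm g)) (by
    intro g i v
    have hu : e.symm (Function.update g i v) =
        Function.update (e.symm g) ((Fintype.equivFin Q).symm i) v := by
      funext x
      simp only [e, Equiv.arrowCongr_symm, Equiv.arrowCongr_apply, Function.comp,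
        Function.update_apply, Equiv.symm_symm, Equiv.refl_symm, Equiv.refl_apply,
        Equiv.eq_symm_apply]
    rw [hu, ← mul_sub, abs_mul, abs_of_nonneg hh0]
    gcongr
    exact hf _ _ _)
  rw [e.symm.sum_comp (fun g => h * f g), ← mul_sum,
    e.symm.sum_comp (fun g => Real.exp (h * (∑ g, f g) / (Fintype.card V : ℝ) ^ q - h * f g))]
    at key
  have hmarkov : (#{g | f g ≤ a - t} : ℝ) * Real.exp (h * t) ≤
      ∑ g, Real.exp (h * (∑ g, f g) / (Fintype.card V : ℝ) ^ q - h * f g) := by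
    rw [← nsmul_eq_mul]
    refine (card_nsmul_le_sum _ (fun g => Real.exp (h * (∑ g, f g) /
      (Fintype.card V : ℝ) ^ q - h * f g)) _ fun g hg => ?_).trans
        (sum_le_sum_of_subset_of_nonneg (filter_subset _ _) fun _ _ _ => (Real.exp_pos _).le)
    rw [mem_filter] at hg
    apply Real.exp_le_exp.2
    have h1 : a ≤ (∑ g, f g) / (Fintype.card V : ℝ) ^ q := (le_div_iff₀ (by positivity)).2 ha
    have h2 : t ≤ (∑ g, f g) / (Fintype.card V : ℝ) ^ q - f g := by linarith [hg.2]
    calc h * t ≤ h * ((∑ g, f g) / (Fintype.card V : ℝ) ^ q - f g) := by gcongr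
      _ = _ := by ring
  have h3 := hmarkov.trans key
  rw [← le_div_iff₀ (Real.exp_pos _), mul_div_assoc, ← Real.exp_sub] at h3
  refine h3.trans (le_of_eq ?_)
  congr 2
  rw [hh]
  field_simp
  ring

end Concentration

section Sampling

open Finset
open scoped Classical

variable {V Q : Type*} [Fintype V] [Fintype Q]

lemma factorial_mul_pow_le_card_image_eq (e : Finset Q) (R : Finset V) (h : #e = #R) :
    (#e).factorial * Fintype.card V ^ (Fintype.card Q - #e) ≤
      #{g : Q → V | e.image g = R} := by
  have hc : Fintype.card ((e ≃ R) × ({x // x ∉ e} → V)) =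
      (#e).factorial * Fintype.card V ^ (Fintype.card Q - #e) := by
    rw [Fintype.card_prod, Fintype.card_equiv (Finset.equivOfCardEq h), Fintype.card_fun,
      Fintype.card_subtype_compl, Fintype.card_coe]
  rw [← hc, ← Finset.card_univ]
  refine card_le_card_of_injOn
    (fun p x => if hx : x ∈ e then (p.1 ⟨x, hx⟩ : V) else p.2 ⟨x, hx⟩) ?_ ?_
  · rintro ⟨π, k⟩ -
    simp only [coe_filter, mem_univ, true_and, Set.mem_ofPred_eq]
    ext v
    simp only [mem_image]
    constructor
    · rintro ⟨x, hx, rfl⟩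
      simp [hx]
    · intro hv
      refine ⟨π.symm ⟨v, hv⟩, by simp, by simp⟩
  · rintro ⟨π, k⟩ - ⟨π', k'⟩ - heq
    simp only [Prod.mk.injEq]
    constructor
    · ext ⟨x, hx⟩
      simpa [hx] using congrFun heq x
    · funext ⟨x, hx⟩
      simpa [hx] using congrFun heq x

/-- The number of `r`-sets mapped by `g` to a member of `𝓛`. -/
noncomputable def imageCount (r : ℕ) (𝓛 : Finset (Finset V)) (g : Q → V) : ℕ :=
  #{e ∈ powersetCard r univ | e.image g ∈ 𝓛}

lemma sum_imageCount_ge {r : ℕ} {𝓛 : Finset (Finset V)} (h𝓛 : ∀ R ∈ 𝓛, #R = r) :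
    (Fintype.card Q).choose r * (r.factorial * Fintype.card V ^ (Fintype.card Q - r) * #𝓛) ≤
      ∑ g : Q → V, imageCount r 𝓛 g := by
  simp only [imageCount, card_filter]
  rw [sum_comm, ← Finset.card_univ (α := Q), ← card_powersetCard, ← smul_eq_mul]
  refine card_nsmul_le_sum _ _ _ fun e he => ?_
  rw [mem_powersetCard] at he
  rw [← card_filter]
  have : ({g : Q → V | e.image g ∈ 𝓛} : Finset (Q → V)) =
      𝓛.biUnion fun R => {g | e.image g = R} := by
    ext g; simp
  rw [this, card_biUnion]
  · rw [mul_comm, ← smul_eq_mul]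
    refine card_nsmul_le_sum _ _ _ fun R hR => ?_
    have := factorial_mul_pow_le_card_image_eq e R (he.2.trans (h𝓛 R hR).symm)
    rwa [he.2] at this
  · intro R _ R' _ hne
    rw [Function.onFun, disjoint_filter]
    rintro g - rfl h
    exact hne h

omit [Fintype V] in
lemma imageCount_update_le {r : ℕ} (𝓛 : Finset (Finset V)) (g : Q → V) (i : Q)
    (v : V) : imageCount r 𝓛 (Function.update g i v) ≤
      imageCount r 𝓛 g + (Fintype.card Q - 1).choose (r - 1) := by
  have hsub : {e ∈ powersetCard r (univ : Finset Q) | e.image (Function.update g i v) ∈ 𝓛} ⊆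
      {e ∈ powersetCard r (univ : Finset Q) | e.image g ∈ 𝓛} ∪
        (powersetCard (r - 1) (univ.erase i)).image (insert i) := by
    intro e he
    simp only [mem_filter, mem_powersetCard, mem_union, mem_image] at he ⊢
    by_cases hi : i ∈ e
    · right
      refine ⟨e.erase i, ⟨erase_subset_erase _ he.1.1, ?_⟩, insert_erase hi⟩
      rw [card_erase_of_mem hi, he.1.2]
    · left
      refine ⟨he.1, ?_⟩
      have : e.image (Function.update g i v) = e.image g := by
        refine image_congr fun x hx => ?_
        rw [Function.update_of_ne]
        rintro rfl
        exact hi hx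
      rw [← this]; exact he.2
  refine (card_le_card hsub).trans ((card_union_le _ _).trans ?_)
  unfold imageCount
  gcongr
  refine card_image_le.trans ?_
  rw [card_powersetCard, card_erase_of_mem (mem_univ i), Finset.card_univ]

/-- The density of a family of `r`-sets on a random sample is concentrated. -/
lemma card_imageCount_le [Nonempty V] {r : ℕ} (hr : 0 < r) (hrq : r ≤ Fintype.card Q)
    {𝓛 : Finset (Finset V)} (h𝓛 : ∀ R ∈ 𝓛, #R = r) {p η : ℝ} (hη : 0 ≤ η)
    (hp : p * (Fintype.card V : ℝ) ^ r ≤ r.factorial * #𝓛) :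
    (#{g : Q → V | (imageCount r 𝓛 g : ℝ) ≤ (p - η) * (Fintype.card Q).choose r} : ℝ) ≤
      (Fintype.card V : ℝ) ^ Fintype.card Q *
        Real.exp (-(η ^ 2 * Fintype.card Q / (2 * r ^ 2))) := by
  set q := Fintype.card Q with hq
  set T : ℝ := (q.choose r : ℝ) with hT
  set c : ℝ := (((q - 1).choose (r - 1) : ℕ) : ℝ) with hc
  have hcpos : 0 < c := by
    rw [hc]; exact_mod_cast Nat.choose_pos (by omega)
  have hqc : (q : ℝ) * c = T * r := by
    have := Nat.add_one_mul_choose_eq (q - 1) (r - 1)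
    rw [Nat.sub_add_cancel (by omega), Nat.sub_add_cancel (by omega)] at this
    rw [hT, hc]; exact_mod_cast this
  have hmain := card_le_mean_sub_le (Q := Q) (fun g => (imageCount r 𝓛 g : ℝ)) hcpos (by
      intro g i v
      have h1 := imageCount_update_le (r := r) 𝓛 g i v
      have h2 := imageCount_update_le (r := r) 𝓛 (Function.update g i v) i (g i)
      rw [Function.update_idem, Function.update_eq_self] at h2
      rw [abs_sub_le_iff, hc]
      constructor
      · rw [sub_le_iff_le_add']; exact_mod_cast h1
      · rw [sub_le_iff_le_add']; exact_mod_cast h2)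
    (a := p * T) (t := η * T) (by positivity) (by
      have h1 := sum_imageCount_ge (Q := Q) h𝓛
      have h2 : (q.choose r : ℝ) * (r.factorial * (Fintype.card V : ℝ) ^ (q - r) * #𝓛) ≤
        ∑ g : Q → V, (imageCount r 𝓛 g : ℝ) := by exact_mod_cast h1
      refine le_trans ?_ h2
      rw [← hT, ← hq]
      calc p * T * (Fintype.card V : ℝ) ^ q
          = T * ((Fintype.card V : ℝ) ^ (q - r) * (p * (Fintype.card V : ℝ) ^ r)) := by
            rw [← Nat.sub_add_cancel hrq, pow_add, Nat.sub_add_cancel hrq]; ring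
        _ ≤ T * ((Fintype.card V : ℝ) ^ (q - r) * (r.factorial * #𝓛)) := by gcongr
        _ = _ := by ring)
  rw [← hq, ← sub_mul] at hmain
  refine hmain.trans (le_of_eq ?_)
  congr 3
  have hq0 : (0 : ℝ) < q := by exact_mod_cast (by omega : 0 < q)
  have hr0 : (0 : ℝ) < r := by exact_mod_cast hr
  have hTc : T = q * c / r := by rw [hqc]; field_simp
  rw [hTc]
  field_simp

end Sampling

section PermSampling

open Finset Equiv
open scoped Classical

variable {V : Type*} [Fintype V]

/-- The edges of `𝓗` between `S₀` and `S`. -/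
noncomputable def edgesBetween (𝓗 : Finset (Finset V)) (S₀ S : Finset V) : Finset (Finset V) :=
  {e ∈ 𝓗 | S₀ ⊆ e ∧ e ⊆ S}

/-- The sets which extend `D` to an edge of `𝓗`. -/
noncomputable def linkSets (𝓗 : Finset (Finset V)) (r : ℕ) (D : Finset V) :
    Finset (Finset V) :=
  {R ∈ powersetCard r univ | Disjoint D R ∧ D ∪ R ∈ 𝓗}

lemma card_linkSets_ge {𝓗 : Finset (Finset V)} {d r : ℕ} (h𝓗 : ∀ e ∈ 𝓗, #e = d + r)
    {D : Finset V} (hD : #D = d) : #{e ∈ 𝓗 | D ⊆ e} ≤ #(linkSets 𝓗 r D) := by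
  refine card_le_card_of_injOn (fun e => e \ D) ?_ ?_
  · intro e he
    simp only [coe_filter, Set.mem_ofPred_eq] at he
    simp only [linkSets, coe_filter, mem_powersetCard, subset_univ, true_and, Set.mem_ofPred_eq]
    refine ⟨?_, disjoint_sdiff, ?_⟩
    · rw [card_sdiff_of_subset he.2, h𝓗 e he.1, hD]; omega
    · rw [union_sdiff_of_subset he.2]; exact he.1
  · intro e he e' he' heq
    simp only [coe_filter, Set.mem_ofPred_eq] at he he'
    simp only at heq
    rw [← union_sdiff_of_subset he.2, heq, union_sdiff_of_subset he'.2]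

lemma imageCount_linkSets_le {𝓗 : Finset (Finset V)} {r : ℕ} (σ : Perm V)
    (D₀ P Q : Finset V) (hDP : D₀ ⊆ P) (hQP : Q ⊆ P) :
    imageCount r (linkSets 𝓗 r (D₀.image σ)) (fun x : Q => σ x) ≤
      #(edgesBetween 𝓗 (D₀.image σ) (P.image σ)) := by
  refine card_le_card_of_injOn (fun e => D₀.image σ ∪ e.image fun x : Q => σ x) ?_ ?_
  · intro e he
    simp only [linkSets, coe_filter, mem_filter, Set.mem_ofPred_eq] at he
    simp only [edgesBetween, coe_filter, Set.mem_ofPred_eq]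
    refine ⟨he.2.2.2, subset_union_left, union_subset (image_subset_image hDP) ?_⟩
    intro y hy
    obtain ⟨x, -, rfl⟩ := mem_image.1 hy
    exact mem_image_of_mem _ (hQP x.2)
  · intro e he e' he' heq
    simp only [linkSets, coe_filter, mem_filter, Set.mem_ofPred_eq] at he he'
    simp only at heq
    have h1 : e.image (fun x : Q => σ x) = e'.image fun x : Q => σ x := by
      rw [← union_sdiff_cancel_left he.2.2.1, heq, union_sdiff_cancel_left he'.2.2.1]
    exact image_injective (σ.injective.comp Subtype.val_injective) h1

/-- For a random permutation conditioned on its values on `Z`, the degree of the image of `D₀` in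
the image of `P` is concentrated. -/
lemma card_eqOn_edgesBetween_lt [Nonempty V] {𝓗 : Finset (Finset V)} {d r m : ℕ} (hr : 0 < r)
    (h𝓗 : ∀ e ∈ 𝓗, #e = d + r) {p p' η : ℝ} (hη : 0 ≤ η)
    (hdeg : ∀ D : Finset V, #D = d →
      p * (Fintype.card V : ℝ) ^ r ≤ r.factorial * #{e ∈ 𝓗 | D ⊆ e})
    {D₀ Z P : Finset V} (hDZ : D₀ ⊆ Z) (hZP : Z ⊆ P) (hD : #D₀ = d) (hZ : #Z ≤ d + 1)
    (hP : #P = m) (hm : d + 1 + r ≤ m)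
    (hp' : ∀ q, m - (d + 1) ≤ q → q ≤ m - d →
      p' * (m - d).choose r ≤ (p - η) * q.choose r)
    (hfac : ∀ q ≤ m, Fintype.card V ^ q * (Fintype.card V - m).factorial ≤
      2 * (Fintype.card V - (m - q)).factorial) (σ₀ : Perm V) :
    (#{σ : Perm V | (∀ v ∈ Z, σ v = σ₀ v) ∧
      (#(edgesBetween 𝓗 (D₀.image σ) (P.image σ)) : ℝ) < p' * (m - d).choose r} : ℝ) ≤
      2 * Real.exp (-(η ^ 2 * ((m - (d + 1) : ℕ) : ℝ) / (2 * r ^ 2))) *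
        #{σ : Perm V | ∀ v ∈ Z, σ v = σ₀ v} := by
  set Q := P \ Z with hQ
  set N := Fintype.card V with hN
  have hQP : Q ⊆ P := sdiff_subset
  have hQc : #Q = m - #Z := by rw [hQ, card_sdiff_of_subset hZP, hP]
  have hZd : d ≤ #Z := hD ▸ card_le_card hDZ
  have hZm : #Z ≤ m := hP ▸ card_le_card hZP
  set 𝓛 := linkSets 𝓗 r (D₀.image σ₀) with h𝓛
  set bad : Finset (Q → V) :=
    {g | (imageCount r 𝓛 g : ℝ) ≤ (p - η) * (Fintype.card Q).choose r} with hbad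
  have hDimg : #(D₀.image σ₀) = d := by rw [card_image_of_injective _ σ₀.injective, hD]
  have hQc' : Fintype.card Q = m - #Z := by rw [Fintype.card_coe, hQc]
  have hconc := card_imageCount_le (Q := Q) (𝓛 := 𝓛) hr (by rw [hQc']; omega)
    (fun R hR => (mem_powersetCard.1 (mem_filter.1 hR).1).2) hη
    ((hdeg _ hDimg).trans (by
      have := card_linkSets_ge h𝓗 hDimg
      gcongr))
  have hsub : ({σ : Perm V | (∀ v ∈ Z, σ v = σ₀ v) ∧
      (#(edgesBetween 𝓗 (D₀.image σ) (P.image σ)) : ℝ) < p' * (m - d).choose r} :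
        Finset (Perm V)) ⊆
      bad.biUnion fun g => ({σ : Perm V | ∀ v ∈ P, σ v =
        if hv : v ∈ Q then g ⟨v, hv⟩ else σ₀ v} : Finset (Perm V)) := by
    intro σ hσ
    simp only [mem_filter, mem_univ, true_and] at hσ
    obtain ⟨hσZ, hσlt⟩ := hσ
    simp only [mem_biUnion, mem_filter, mem_univ, true_and, hbad]
    refine ⟨fun x => σ x, ?_, ?_⟩
    · have h1 := imageCount_linkSets_le (𝓗 := 𝓗) (r := r) σ D₀ P Q (hDZ.trans hZP) hQP
      have h2 : D₀.image σ = D₀.image σ₀ := image_congr fun x hx => hσZ x (hDZ hx)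
      have h3 : imageCount r 𝓛 (fun x : Q => σ x) ≤
          #(edgesBetween 𝓗 (D₀.image σ) (P.image σ)) := by rwa [h𝓛, ← h2]
      have h4 : (imageCount r 𝓛 (fun x : Q => σ x) : ℝ) ≤
          #(edgesBetween 𝓗 (D₀.image σ) (P.image σ)) := by exact_mod_cast h3
      refine h4.trans (hσlt.le.trans ?_)
      rw [hQc']
      exact hp' _ (by omega) (by omega)
    · intro v hv
      split_ifs with h
      · rfl
      · apply hσZ
        by_contra hvZ
        exact h (mem_sdiff.2 ⟨hv, hvZ⟩)
  have hcount : #{σ : Perm V | (∀ v ∈ Z, σ v = σ₀ v) ∧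
      (#(edgesBetween 𝓗 (D₀.image σ) (P.image σ)) : ℝ) < p' * (m - d).choose r} ≤
      #bad * (N - m).factorial := by
    refine (card_le_card hsub).trans (card_biUnion_le_card_mul _ _ _ fun g _ => ?_)
    rw [hN, ← hP]
    exact card_perm_eqOn_le P _
  have hfac' : ((N : ℝ) ^ (m - #Z)) * (N - m).factorial ≤ 2 * (N - #Z).factorial := by
    have := hfac (m - #Z) (by omega)
    rw [Nat.sub_sub_self hZm] at this
    exact_mod_cast this
  rw [card_perm_eqOn, ← hN]
  rw [hQc'] at hconc
  have hbadle : (#bad : ℝ) ≤ (N : ℝ) ^ (m - #Z) *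
      Real.exp (-(η ^ 2 * ((m - (d + 1) : ℕ) : ℝ) / (2 * r ^ 2))) := by
    have h1 : (#bad : ℝ) ≤ (N : ℝ) ^ (m - #Z) *
        Real.exp (-(η ^ 2 * ((m - #Z : ℕ) : ℝ) / (2 * r ^ 2))) := by
      rw [hbad, hQc']
      convert hconc
    refine h1.trans ?_
    gcongr
  calc _ ≤ (#bad : ℝ) * (N - m).factorial := by exact_mod_cast hcount
    _ ≤ ((N : ℝ) ^ (m - #Z) *
      Real.exp (-(η ^ 2 * ((m - (d + 1) : ℕ) : ℝ) / (2 * r ^ 2)))) * (N - m).factorial := by gcongr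
    _ = Real.exp (-(η ^ 2 * ((m - (d + 1) : ℕ) : ℝ) / (2 * r ^ 2))) *
        ((N : ℝ) ^ (m - #Z) * (N - m).factorial) := by ring
    _ ≤ Real.exp (-(η ^ 2 * ((m - (d + 1) : ℕ) : ℝ) / (2 * r ^ 2))) *
        (2 * (N - #Z).factorial) := by gcongr
    _ = _ := by ring

/-- A bound that holds conditionally on the values on `Z` holds conditionally on a single value. -/
lemma card_filter_apply_eq_le_of_eqOn {Z : Finset V} {x : V} (hx : x ∈ Z) (R : Perm V → Prop)
    {β : ℝ} (h : ∀ σ₀ : Perm V, (#{σ : Perm V | (∀ v ∈ Z, σ v = σ₀ v) ∧ R σ} : ℝ) ≤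
      β * #{σ : Perm V | ∀ v ∈ Z, σ v = σ₀ v}) (y : V) :
    (#{σ : Perm V | σ x = y ∧ R σ} : ℝ) * Fintype.card V ≤
      β * (Fintype.card V).factorial := by
  have : Nonempty V := ⟨x⟩
  set N := Fintype.card V with hN
  set c := (N - #Z).factorial with hc
  have hc0 : (0 : ℝ) < c := by exact_mod_cast Nat.factorial_pos _
  have hdouble : (#{σ : Perm V | σ x = y ∧ R σ}) * c =
      ∑ σ₀ : Perm V with σ₀ x = y, #{σ : Perm V | (∀ v ∈ Z, σ v = σ₀ v) ∧ R σ} := by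
    calc _ = ∑ σ : Perm V with σ x = y ∧ R σ, #{σ₀ : Perm V | ∀ v ∈ Z, σ₀ v = σ v} := by
          simp only [card_perm_eqOn, ← hN, ← hc, sum_const, smul_eq_mul]
      _ = _ := by
          simp only [card_eq_sum_ones]
          refine sum_comm' fun σ σ₀ => ?_
          simp only [mem_filter, mem_univ, true_and]
          constructor
          · rintro ⟨⟨h₁, h₂⟩, h₃⟩
            exact ⟨⟨fun v hv => (h₃ v hv).symm, h₂⟩, (h₃ x hx).trans h₁⟩
          · rintro ⟨⟨h₁, h₂⟩, h₃⟩
            exact ⟨⟨(h₁ x hx).trans h₃, h₂⟩, fun v hv => (h₁ v hv).symm⟩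
  have hone : #{σ : Perm V | σ x = y} * N = N.factorial := by
    have := card_perm_eqOn {x} (swap x y)
    simp only [mem_singleton, forall_eq, swap_apply_left, card_singleton] at this
    rw [this, ← hN, mul_comm, Nat.mul_factorial_pred]
    exact Fintype.card_ne_zero
  have hsum : (#{σ : Perm V | σ x = y ∧ R σ} : ℝ) * c ≤ β * #{σ : Perm V | σ x = y} * c := by
    have h1 : ((#{σ : Perm V | σ x = y ∧ R σ} : ℝ)) * c =
        ∑ σ₀ : Perm V with σ₀ x = y, (#{σ : Perm V | (∀ v ∈ Z, σ v = σ₀ v) ∧ R σ} : ℝ) := by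
      exact_mod_cast hdouble
    rw [h1]
    refine (sum_le_sum fun σ₀ _ => h σ₀).trans (le_of_eq ?_)
    simp only [card_perm_eqOn, ← hN, ← hc, sum_const, nsmul_eq_mul]
    ring
  have h2 := le_of_mul_le_mul_right hsum hc0
  calc _ ≤ β * #{σ : Perm V | σ x = y} * N := by gcongr
    _ = β * (#{σ : Perm V | σ x = y} * N : ℕ) := by push_cast; ring
    _ = _ := by rw [hone]

end PermSampling

section Asymptotics

open Finset Equiv Filter
open scoped Classical

lemma pow_mul_factorial_sub_le_two_mul {N m q : ℕ} (hq : q ≤ m) (hm : 2 * m ^ 2 ≤ N)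
    (hmN : m ≤ N) : N ^ q * (N - m).factorial ≤ 2 * (N - (m - q)).factorial := by
  have h1 := Nat.factorial_mul_pow_le_factorial (m := N - m) (n := q)
  rw [show N - m + q = N - (m - q) by omega] at h1
  have h2 : N ^ q ≤ 2 * (N - m + 1) ^ q := by
    rcases N.eq_zero_or_pos with rfl | hN
    · have : m = 0 := by omega
      subst this
      have : q = 0 := by omega
      subst this
      simp
    have hN' : (0 : ℝ) < N := by exact_mod_cast hN
    have h3 : (1 : ℝ) / 2 ≤ (1 - m / N) ^ q := by
      have hle : (m : ℝ) / N ≤ 1 := by rw [div_le_one hN']; exact_mod_cast hmN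
      have := one_add_mul_le_pow (a := -((m : ℝ) / N)) (by linarith) q
      rw [← sub_eq_add_neg] at this
      refine le_trans ?_ this
      have h4 : (q : ℝ) * (m / N) ≤ 1 / 2 := by
        rw [← mul_div_assoc, div_le_div_iff₀ hN' two_pos]
        have : (q : ℝ) * m ≤ m ^ 2 := by
          rw [sq]; gcongr
        have h5 : (2 : ℝ) * m ^ 2 ≤ N := by exact_mod_cast hm
        linarith
      linarith
    have h6 : ((N : ℝ)) ^ q ≤ 2 * ((N - m : ℕ) + 1) ^ q := by
      calc (N : ℝ) ^ q = 2 * (N ^ q * (1 / 2)) := by ring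
        _ ≤ 2 * (N ^ q * (1 - m / N) ^ q) := by gcongr
        _ = 2 * ((N : ℝ) - m) ^ q := by
          rw [← mul_pow]; congr 2; field_simp
        _ ≤ _ := by
          rw [Nat.cast_sub hmN]
          have : (m : ℝ) ≤ N := by exact_mod_cast hmN
          gcongr
          linarith
    exact_mod_cast h6
  calc N ^ q * (N - m).factorial ≤ 2 * (N - m + 1) ^ q * (N - m).factorial := by gcongr
    _ = 2 * ((N - m).factorial * (N - m + 1) ^ q) := by ring
    _ ≤ _ := by gcongr

lemma exists_forall_mul_pow_le_factorial_mul_choose (d r : ℕ) {p' p : ℝ} (hp' : p' < p)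
    (hp : 0 ≤ p) : ∃ N₀ : ℕ, ∀ N ≥ N₀,
      p' * (N : ℝ) ^ r ≤ p * (r.factorial * (N - d).choose r) := by
  have hlim : Tendsto (fun N : ℕ => p * (1 - ((d + r : ℕ) : ℝ) / N) ^ r) atTop (nhds p) := by
    have := ((tendsto_const_div_atTop_nhds_zero_nat ((d + r : ℕ) : ℝ)).const_sub 1).pow r
    simpa using this.const_mul p
  obtain ⟨N₀, hN₀⟩ := eventually_atTop.1 (hlim.eventually (lt_mem_nhds hp'))
  refine ⟨N₀ + d + r + 1, fun N hN => ?_⟩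
  have hN' : (0 : ℝ) < N := by exact_mod_cast (by omega : 0 < N)
  have h1 : ((N : ℝ) - (d + r : ℕ)) ^ r ≤ r.factorial * (N - d).choose r := by
    have h2 : (N - (d + r)) ^ r ≤ (N - d).descFactorial r :=
      le_trans (Nat.pow_le_pow_left (by omega) r) (Nat.pow_sub_le_descFactorial (N - d) r)
    rw [Nat.descFactorial_eq_factorial_mul_choose] at h2
    rw [← Nat.cast_sub (by omega)]
    exact_mod_cast h2
  calc p' * (N : ℝ) ^ r ≤ p * (1 - ((d + r : ℕ) : ℝ) / N) ^ r * (N : ℝ) ^ r := by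
        gcongr
        exact (hN₀ N (by omega)).le
    _ = p * ((N : ℝ) - (d + r : ℕ)) ^ r := by
        rw [mul_assoc, ← mul_pow]; congr 2; field_simp
    _ ≤ _ := by gcongr

lemma exists_forall_mul_choose_le (d r : ℕ) {p₁ p₂ : ℝ} (h : p₁ < p₂) :
    ∃ m₀ : ℕ, ∀ m ≥ m₀, ∀ q, m - (d + 1) ≤ q → q ≤ m - d →
      p₁ * (m - d).choose r ≤ p₂ * q.choose r := by
  obtain ⟨M₀, hM₀⟩ := exists_nat_ge (p₂ * r / (p₂ - p₁))
  rw [div_le_iff₀ (by linarith)] at hM₀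
  refine ⟨M₀ + d + r + 1, fun m hm q hq₁ hq₂ => ?_⟩
  obtain ⟨M, rfl⟩ : ∃ M, m = M + 1 + d := ⟨m - d - 1, by omega⟩
  rw [Nat.add_sub_cancel] at hq₂ ⊢
  rcases eq_or_ne q (M + 1) with rfl | hne
  · gcongr
  obtain rfl : q = M := by omega
  have h1 : (q.choose r : ℝ) * (q + 1) = (q + 1).choose r * ((q + 1 : ℝ) - r) := by
    rw [← Nat.cast_add_one, ← Nat.cast_sub (by omega)]
    exact_mod_cast Nat.choose_mul_succ_eq q r
  have h2 : p₁ * (q + 1 : ℝ) ≤ p₂ * ((q + 1 : ℝ) - r) := by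
    have : (M₀ : ℝ) ≤ q + 1 := by exact_mod_cast (by omega : M₀ ≤ q + 1)
    nlinarith
  refine le_of_mul_le_mul_right ?_ (by positivity : (0 : ℝ) < q + 1)
  calc p₁ * (q + 1).choose r * (q + 1 : ℝ) = (q + 1).choose r * (p₁ * (q + 1)) := by ring
    _ ≤ (q + 1).choose r * (p₂ * ((q + 1 : ℝ) - r)) := by gcongr
    _ = p₂ * ((q + 1).choose r * ((q + 1 : ℝ) - r)) := by ring
    _ = _ := by rw [← h1]; ring

/-- The minimum degree condition is inherited by a random set with overwhelming probability,
even after fixing one value of the random permutation. -/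
lemma exists_card_apply_eq_edgesBetween_lt (d : ℕ) {r : ℕ} (hr : 0 < r) {δ α : ℝ} (hδ : 0 ≤ δ)
    (hα : 0 < α) : ∃ m₀ : ℕ, ∀ m ≥ m₀, ∃ N₀ : ℕ, ∀ (V : Type) [Fintype V],
      N₀ ≤ Fintype.card V → ∀ 𝓗 : Finset (Finset V), (∀ e ∈ 𝓗, #e = d + r) →
      (∀ D : Finset V, #D = d →
        (δ + α) * (Fintype.card V - d).choose r ≤ (#{e ∈ 𝓗 | D ⊆ e} : ℝ)) →
      ∀ (D₀ P : Finset V) (x y : V), D₀ ⊆ P → x ∈ P → #D₀ = d → #P = m →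
      (#{σ : Perm V | σ x = y ∧ (#(edgesBetween 𝓗 (D₀.image σ) (P.image σ)) : ℝ) <
        (δ + α / 2) * (m - d).choose r} : ℝ) * Fintype.card V ≤
      2 * Real.exp (-((α / 8) ^ 2 * ((m - (d + 1) : ℕ) : ℝ) / (2 * r ^ 2))) *
        (Fintype.card V).factorial := by
  obtain ⟨m₀, hm₀⟩ := exists_forall_mul_choose_le d r (p₁ := δ + α / 2)
    (p₂ := δ + 7 * α / 8 - α / 8) (by linarith)
  obtain ⟨N₀, hN₀⟩ := exists_forall_mul_pow_le_factorial_mul_choose d r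
    (p' := δ + 7 * α / 8) (p := δ + α) (by linarith) (by positivity)
  refine ⟨m₀ + d + 1 + r, fun m hm => ⟨N₀ + m + 2 * m ^ 2, ?_⟩⟩
  intro V _ hV 𝓗 h𝓗 hdeg D₀ P x y hDP hxP hD hP
  have : Nonempty V := ⟨x⟩
  refine card_filter_apply_eq_le_of_eqOn (mem_insert_self x D₀) _ (fun σ₀ => ?_) y
  refine card_eqOn_edgesBetween_lt hr h𝓗 (p := δ + 7 * α / 8) (by positivity) (fun D hD => ?_)
    (subset_insert x D₀) (insert_subset hxP hDP) hD (hD ▸ card_insert_le x D₀) hP (by omega)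
    (hm₀ m (by omega)) (fun q hq => pow_mul_factorial_sub_le_two_mul hq (by omega) (by omega)) σ₀
  refine (hN₀ _ (by omega)).trans ?_
  calc (δ + α) * (r.factorial * (Fintype.card V - d).choose r)
      = r.factorial * ((δ + α) * (Fintype.card V - d).choose r) := by ring
    _ ≤ _ := by gcongr; exact hdeg D hD

end Asymptotics

section GoodClusters

open Finset Equiv
open scoped Classical

variable {V W J : Type*} [Fintype V] [Fintype W]

/-- The vertex set `S` and the color set `T` satisfy a minimum `d`-degree condition. -/
def IsGoodPair (Hs : W → Finset (Finset V)) (d : ℕ) (θ : ℝ) (S : Finset V) (T : Finset W) : Prop :=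
  ∀ i ∈ T, ∀ D ⊆ S, #D = d → θ ≤ #(edgesBetween (Hs i) D S)

omit [Fintype W] in
lemma card_not_isGoodPair_le {Hs : W → Finset (Finset V)} {d : ℕ} {θ β : ℝ} {K : ℕ} {P : Finset V}
    {C : Finset W} (hP : #P ≤ K) (hC : #C ≤ K) (hβ : 0 ≤ β) {x y : V}
    (h : ∀ w, ∀ D₀ ⊆ P, #D₀ = d →
      (#{σ : Perm V | σ x = y ∧ (#(edgesBetween (Hs w) (D₀.image σ) (P.image σ)) : ℝ) < θ} : ℝ) *
        Fintype.card V ≤ β * (Fintype.card V).factorial) (σ₂ : Perm W) :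
    (#{σ : Perm V | σ x = y ∧ ¬ IsGoodPair Hs d θ (P.image σ) (C.image σ₂)} : ℝ) *
      Fintype.card V ≤ K ^ (d + 1) * β * (Fintype.card V).factorial := by
  have hsub : ({σ : Perm V | σ x = y ∧ ¬ IsGoodPair Hs d θ (P.image σ) (C.image σ₂)} :
      Finset (Perm V)) ⊆ (C ×ˢ powersetCard d P).biUnion fun z =>
        ({σ : Perm V | σ x = y ∧
          (#(edgesBetween (Hs (σ₂ z.1)) (z.2.image σ) (P.image σ)) : ℝ) < θ} :
            Finset (Perm V)) := by
    intro σ hσ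
    obtain ⟨-, hσ, hbad⟩ := mem_filter.1 hσ
    unfold IsGoodPair at hbad
    push Not at hbad
    obtain ⟨i, hi, D, hD, hDd, hlt⟩ := hbad
    obtain ⟨w, hw, rfl⟩ := mem_image.1 hi
    obtain ⟨D₀, hD₀, rfl⟩ := subset_image_iff.1 hD
    rw [card_image_of_injective _ σ.injective] at hDd
    simp only [mem_biUnion, mem_product, mem_powersetCard, mem_filter, mem_univ, true_and]
    exact ⟨(w, D₀), ⟨hw, hD₀, hDd⟩, hσ, hlt⟩
  calc _ ≤ (∑ z ∈ C ×ˢ powersetCard d P, (#{σ : Perm V | σ x = y ∧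
          (#(edgesBetween (Hs (σ₂ z.1)) (z.2.image σ) (P.image σ)) : ℝ) < θ} : ℝ)) *
            Fintype.card V := by
        gcongr
        exact_mod_cast (card_le_card hsub).trans card_biUnion_le
    _ ≤ ∑ z ∈ C ×ˢ powersetCard d P, β * (Fintype.card V).factorial := by
        rw [sum_mul]
        refine sum_le_sum fun z hz => ?_
        obtain ⟨-, hz⟩ := mem_product.1 hz
        rw [mem_powersetCard] at hz
        exact h _ _ hz.1 hz.2
    _ ≤ K ^ (d + 1) * (β * (Fintype.card V).factorial) := by
        rw [sum_const, nsmul_eq_mul, card_product, card_powersetCard]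
        gcongr
        have : #C * (#P).choose d ≤ K ^ (d + 1) := by
          rw [pow_succ']
          exact Nat.mul_le_mul hC ((Nat.choose_le_pow _ _).trans (Nat.pow_le_pow_left hP d))
        exact_mod_cast this
    _ = _ := by ring

lemma card_filter_prod_le {A B : Type*} [Fintype A] [Fintype B] (R : A × B → Prop) {c : ℝ}
    (h : ∀ b, (#{a | R (a, b)} : ℝ) ≤ c) : (#{x | R x} : ℝ) ≤ Fintype.card B * c := by
  have : (#{x | R x} : ℝ) = ∑ b, (#{a | R (a, b)} : ℝ) := by
    simp only [card_filter, Nat.cast_sum, Fintype.sum_prod_type_right]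
  rw [this]
  refine (sum_le_sum fun b _ => h b).trans ?_
  rw [sum_const, nsmul_eq_mul, card_univ]

lemma card_filter_perm_eq_sum_apply (R : V → Perm V → Prop) (v : V) :
    #{σ : Perm V | R (σ⁻¹ v) σ} = ∑ x, #{σ : Perm V | σ x = v ∧ R x σ} := by
  rw [← card_biUnion]
  · congr 1
    ext σ
    simp only [mem_filter, mem_univ, true_and, mem_biUnion]
    constructor
    · intro h
      exact ⟨σ⁻¹ v, by simp, h⟩
    · rintro ⟨x, rfl, h⟩
      simpa using h
  · intro x _ x' _ hne
    rw [Function.onFun, disjoint_left]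
    intro σ h h'
    simp only [mem_filter, mem_univ, true_and] at h h'
    exact hne (σ.injective (h.1.trans h'.1.symm))

/-- If clusters are unlikely to be bad, even after fixing one vertex, there is a large well-spread
family of pairs of permutations for which no cluster is bad. -/
lemma exists_family_not_bad {clV : V → J} {clW : W → J} {bad : J → Perm V × Perm W → Prop} {K : ℕ}
    {ε : ℝ} (hne : ∀ j, ∃ x, clV x = j) (hK₀ : 0 < K)
    (hK : ∀ j, #{y | Sum.elim clV clW y = j} ≤ K) (hε : 8 * K * ε ≤ 1)
    (hloc : ∀ j (g h : Perm V × Perm W), (∀ v, clV v = j → g.1 v = h.1 v) →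
      (∀ w, clW w = j → g.2 w = h.2 w) → bad j g → bad j h)
    (hpoint : ∀ x v σ₂, (#{σ : Perm V | σ x = v ∧ bad (clV x) (σ, σ₂)} : ℝ) *
      Fintype.card V ≤ ε * (Fintype.card V).factorial) :
    ∃ 𝓖 : Finset (Perm V × Perm W), 𝓖.Nonempty ∧ (∀ g ∈ 𝓖, ∀ j, ¬ bad j g) ∧
      ∀ A, #{g ∈ 𝓖 | Realizes (Perm.sumCongrHom V W) A g} * Fintype.card (Perm V × Perm W) ≤
        2 ^ #A * #(realizers (Perm.sumCongrHom V W) A) * #𝓖 := by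
  obtain ⟨c, hc⟩ : ∃ c : ℝ, c = ε * (Fintype.card V).factorial := ⟨_, rfl⟩
  rw [← hc] at hpoint
  have hsumV : ∀ (f : V → ℝ), (∀ x, f x * Fintype.card V ≤ c) → Nonempty V → ∑ x, f x ≤ c := by
    intro f hf hV
    have hpos : (0 : ℝ) < Fintype.card V := by exact_mod_cast Fintype.card_pos
    refine le_of_mul_le_mul_right ?_ hpos
    rw [sum_mul]
    refine (sum_le_sum fun x _ => hf x).trans ?_
    rw [sum_const, nsmul_eq_mul, card_univ, mul_comm]
  have hcluster : ∀ j σ₂, (#{σ : Perm V | bad j (σ, σ₂)} : ℝ) ≤ c := by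
    intro j σ₂
    obtain ⟨x, rfl⟩ := hne j
    have h1 : #{σ : Perm V | bad (clV x) (σ, σ₂)} =
        ∑ v, #{σ : Perm V | σ x = v ∧ bad (clV x) (σ, σ₂)} := by
      rw [card_eq_sum_card_fiberwise (f := fun σ : Perm V => σ x) (t := univ) (by simp)]
      simp only [filter_filter, and_comm]
    rw [h1, Nat.cast_sum]
    exact hsumV _ (fun v => hpoint x v σ₂) ⟨x⟩
  have hcardG : Fintype.card (Perm V × Perm W) =
      Fintype.card (Perm W) * (Fintype.card V).factorial := by
    rw [Fintype.card_prod, Fintype.card_perm, mul_comm]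
  have hfin : ∀ R : Perm V × Perm W → Prop, (∀ σ₂, (#{σ | R (σ, σ₂)} : ℝ) ≤ c) →
      8 * K * #{g | R g} ≤ Fintype.card (Perm V × Perm W) := by
    intro R hR
    have h1 := card_filter_prod_le R hR
    have h2 : (8 * K * #{g | R g} : ℝ) ≤ Fintype.card (Perm W) * (Fintype.card V).factorial := by
      calc (8 * K * #{g | R g} : ℝ) ≤ 8 * K * (Fintype.card (Perm W) * c) := by gcongr
        _ = Fintype.card (Perm W) * (Fintype.card V).factorial * (8 * K * ε) := by rw [hc]; ring
        _ ≤ Fintype.card (Perm W) * (Fintype.card V).factorial * 1 := by gcongr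
        _ = _ := mul_one _
    rw [hcardG]
    exact_mod_cast h2
  have hloc' : ∀ j (g h : Perm V × Perm W), (∀ x, Sum.elim clV clW x = j →
      Perm.sumCongrHom V W g x = Perm.sumCongrHom V W h x) → bad j g → bad j h := by
    refine fun j g h heq => hloc j g h (fun v hv => ?_) fun w hw => ?_
    · simpa using heq (Sum.inl v) hv
    · simpa using heq (Sum.inr w) hw
  obtain ⟨𝓖, h𝓖, hgood, hspread⟩ := hasSwaps_sumCongrHom.exists_no_bad_cluster hloc' hK₀
    (fun x => hK _) (fun x => hfin _ fun σ₂ => hcluster _ σ₂) (by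
      rintro (v | w)
      · refine hfin (fun g => bad (clV (g.1⁻¹ v)) g) fun σ₂ => ?_
        rw [card_filter_perm_eq_sum_apply (fun x σ => bad (clV x) (σ, σ₂)) v, Nat.cast_sum]
        exact hsumV _ (fun x => hpoint x v σ₂) ⟨v⟩
      · exact hfin (fun g => bad (clW (g.2⁻¹ w)) g) fun σ₂ => hcluster (clW (σ₂⁻¹ w)) σ₂)
  refine ⟨𝓖, h𝓖, fun g hg j => ?_, fun A => ?_⟩
  · obtain ⟨x, rfl⟩ := hne j
    exact hgood g hg (Sum.inl x)
  · convert hspread A using 3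
    ext g
    simp [realizers, and_comm]

/-- There is a large well-spread family of pairs of permutations which make all clusters good. -/
lemma exists_family_isGoodPair {Hs : W → Finset (Finset V)} {clV : V → J} {clW : W → J} {d K : ℕ}
    {θ : J → ℝ} {β : ℝ} (hne : ∀ j, ∃ x, clV x = j) (hK₀ : 0 < K)
    (hK : ∀ j, #{y | Sum.elim clV clW y = j} ≤ K) (hβ : 0 ≤ β)
    (hβK : 8 * K * (K ^ (d + 1) * β) ≤ 1)
    (h : ∀ w x y, ∀ D₀ ⊆ ({v | clV v = clV x} : Finset V), #D₀ = d →
      (#{σ : Perm V | σ x = y ∧ (#(edgesBetween (Hs w) (D₀.image σ)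
        (({v | clV v = clV x} : Finset V).image σ)) : ℝ) < θ (clV x)} : ℝ) *
        Fintype.card V ≤ β * (Fintype.card V).factorial) :
    ∃ 𝓖 : Finset (Perm V × Perm W), 𝓖.Nonempty ∧
      (∀ g ∈ 𝓖, ∀ j, IsGoodPair Hs d (θ j) (({v | clV v = j} : Finset V).image g.1)
        (({w | clW w = j} : Finset W).image g.2)) ∧
      ∀ A, #{g ∈ 𝓖 | Realizes (Perm.sumCongrHom V W) A g} * Fintype.card (Perm V × Perm W) ≤
        2 ^ #A * #(realizers (Perm.sumCongrHom V W) A) * #𝓖 := by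
  have hPK : ∀ j, #{v | clV v = j} ≤ K := fun j =>
    (card_le_card_of_injOn Sum.inl (fun v hv => by simpa using hv) Sum.inl_injective.injOn).trans
      (hK j)
  have hCK : ∀ j, #{w | clW w = j} ≤ K := fun j =>
    (card_le_card_of_injOn Sum.inr (fun v hv => by simpa using hv) Sum.inr_injective.injOn).trans
      (hK j)
  have hloc : ∀ j (g h : Perm V × Perm W), (∀ v, clV v = j → g.1 v = h.1 v) →
      (∀ w, clW w = j → g.2 w = h.2 w) →
      ¬ IsGoodPair Hs d (θ j) (({v | clV v = j} : Finset V).image g.1)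
        (({w | clW w = j} : Finset W).image g.2) →
      ¬ IsGoodPair Hs d (θ j) (({v | clV v = j} : Finset V).image h.1)
        (({w | clW w = j} : Finset W).image h.2) := by
    intro j g h h₁ h₂ hb
    rwa [← image_congr (f := g.1) (g := h.1) (fun v hv => h₁ v (by simpa using hv)),
      ← image_congr (f := g.2) (g := h.2) (fun v hv => h₂ v (by simpa using hv))]
  obtain ⟨𝓖, h𝓖, hgood, hspread⟩ := exists_family_not_bad (bad := fun j g =>
    ¬ IsGoodPair Hs d (θ j) (({v | clV v = j} : Finset V).image g.1)
      (({w | clW w = j} : Finset W).image g.2)) hne hK₀ hK hβK hloc fun x v σ₂ => by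
        convert card_not_isGoodPair_le (hPK (clV x)) (hCK (clV x)) hβ
          (fun w D₀ => h w x v D₀) σ₂
  exact ⟨𝓖, h𝓖, fun g hg j => not_not.1 (hgood g hg j), hspread⟩

end GoodClusters

section Factors

open Finset
open scoped Classical

lemma transversalDiracThreshold_nonneg (k s t d : ℕ) (F : Finset (Finset (Fin s))) :
    0 ≤ transversalDiracThreshold k s t d F :=
  Real.sInf_nonneg fun _ hδ => hδ.1.le

/-- Above the threshold, systems on many vertices have transversal factors. -/
lemma exists_forall_isTransversalFFactor {k s t d : ℕ} (hs : 0 < s) (ht : 0 < t) (hd : d ≤ k)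
    (F : Finset (Finset (Fin s))) {α : ℝ} (hα : 0 < α) : ∃ n₀ : ℕ, ∀ n : ℕ, n₀ ≤ n →
    ∀ Hs : Fin (t * n) → Finset (Finset (Fin (s * n))), (∀ i, ∀ e ∈ Hs i, #e = k) →
      (∀ i (D : Finset (Fin (s * n))), #D = d →
        (transversalDiracThreshold k s t d F + α) * ((s * n - d).choose (k - d) : ℝ) ≤
          (#{e ∈ Hs i | D ⊆ e} : ℝ)) →
      IsTransversalFFactor F Hs := by
  have hne : {δ : ℝ | 0 < δ ∧ ∀ α : ℝ, 0 < α → ∃ n₀ : ℕ, ∀ n : ℕ, n₀ ≤ n →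
    ∀ Hs : Fin (t * n) → Finset (Finset (Fin (s * n))),
      (∀ i, ∀ e ∈ Hs i, e.card = k) →
      (∀ i (D : Finset (Fin (s * n))), D.card = d →
        (δ + α) * ((s * n - d).choose (k - d) : ℝ) ≤
          (((Hs i).filter fun e => D ⊆ e).card : ℝ)) →
      IsTransversalFFactor F Hs}.Nonempty := by
    refine ⟨1, one_pos, fun α hα => ⟨k + 1, fun n hn Hs hHs hdeg => ?_⟩⟩
    exfalso
    have hkn : k ≤ s * n := (by omega : k ≤ n).trans (Nat.le_mul_of_pos_left n hs)
    have htn : 0 < t * n := Nat.mul_pos ht (by omega)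
    obtain ⟨D, -, hD⟩ := exists_subset_card_eq (s := (univ : Finset (Fin (s * n)))) (n := d)
      (by simpa using hd.trans hkn)
    have h1 := hdeg ⟨0, htn⟩ D hD
    have h2 : #{e ∈ Hs ⟨0, htn⟩ | D ⊆ e} ≤ (s * n - d).choose (k - d) := by
      calc _ ≤ #(powersetCard (k - d) (univ \ D)) := by
            refine card_le_card_of_injOn (fun e => e \ D) ?_ ?_
            · intro e he
              simp only [coe_filter, Set.mem_ofPred_eq] at he
              refine mem_coe.2 <| mem_powersetCard.2 ⟨sdiff_subset_sdiff (subset_univ _) le_rfl, ?_⟩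
              rw [card_sdiff_of_subset he.2, hHs _ _ he.1, hD]
            · intro e he e' he' heq
              simp only [coe_filter, Set.mem_ofPred_eq] at he he'
              simp only at heq
              rw [← union_sdiff_of_subset he.2, heq, union_sdiff_of_subset he'.2]
        _ = _ := by
            rw [card_powersetCard, card_sdiff_of_subset (subset_univ _), card_univ,
              Fintype.card_fin, hD]
    have h3 : 0 < (s * n - d).choose (k - d) := Nat.choose_pos (by omega)
    have h2' : (#{e ∈ Hs ⟨0, htn⟩ | D ⊆ e} : ℝ) ≤ ((s * n - d).choose (k - d) : ℝ) := by
      exact_mod_cast h2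
    have h3' : (0 : ℝ) < ((s * n - d).choose (k - d) : ℝ) := by exact_mod_cast h3
    have h1' : (1 + α) * ((s * n - d).choose (k - d) : ℝ) ≤
        (#{e ∈ Hs ⟨0, htn⟩ | D ⊆ e} : ℝ) := by convert h1
    nlinarith
  obtain ⟨δ, ⟨-, hδ⟩, hlt⟩ := exists_lt_of_csInf_lt hne
    (lt_add_of_pos_right (transversalDiracThreshold k s t d F) (half_pos hα))
  obtain ⟨n₀, hn₀⟩ := hδ (α / 2) (half_pos hα)
  refine ⟨n₀, fun n hn Hs hHs hdeg => hn₀ n hn Hs hHs fun i D hD => ?_⟩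
  have h1 := hdeg i D hD
  calc _ ≤ (transversalDiracThreshold k s t d F + α) * ((s * n - d).choose (k - d) : ℝ) := by
        exact mul_le_mul_of_nonneg_right (by linarith) (Nat.cast_nonneg _)
    _ ≤ _ := by convert h1

variable {V W : Type*}

/-- A good pair of a vertex set and a color set contains a transversal factor. -/
lemma IsGoodPair.exists_factor {s t k d ℓ : ℕ} {θ : ℝ} {fF : Fin t → Finset (Fin s)}
    (hfF : Function.Injective fF)
    (hfac : ∀ Hs : Fin (t * ℓ) → Finset (Finset (Fin (s * ℓ))), (∀ i, ∀ e ∈ Hs i, #e = k) →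
      (∀ i (D : Finset (Fin (s * ℓ))), #D = d → θ ≤ (#{e ∈ Hs i | D ⊆ e} : ℝ)) →
      IsTransversalFFactor (univ.image fF) Hs)
    {Hs : W → Finset (Finset V)} (hHs : ∀ i, ∀ e ∈ Hs i, #e = k) {S : Finset V} {T : Finset W}
    (hS : #S = s * ℓ) (hT : #T = t * ℓ) (h : IsGoodPair Hs d θ S T) {M : Type*} [Fintype M]
    (hM : Fintype.card M = ℓ) :
    ∃ (a : Fin s × M → V) (b : Fin t × M → W), a.Injective ∧ b.Injective ∧ (∀ x, a x ∈ S) ∧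
      (∀ x, b x ∈ T) ∧ ∀ m j, (fF j).image (fun v => a (v, m)) ∈ Hs (b (j, m)) := by
  let eS : Fin (s * ℓ) ≃ S := (S.equivFinOfCardEq hS).symm
  let eT : Fin (t * ℓ) ≃ T := (T.equivFinOfCardEq hT).symm
  let eM : M ≃ Fin ℓ := Fintype.equivFinOfCardEq hM
  have hιinj : Function.Injective fun x => (eS x : V) := Subtype.val_injective.comp eS.injective
  have hcard : ∀ i : Fin (t * ℓ), ∀ e ∈ ({e | e.image (fun x => (eS x : V)) ∈ Hs (eT i)} :
      Finset (Finset (Fin (s * ℓ)))), #e = k := by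
    intro i e he
    rw [← card_image_of_injective e hιinj]
    exact hHs _ _ (mem_filter.1 he).2
  have hdeg : ∀ (i : Fin (t * ℓ)) (D : Finset (Fin (s * ℓ))), #D = d →
      θ ≤ (#{e ∈ ({e | e.image (fun x => (eS x : V)) ∈ Hs (eT i)} :
        Finset (Finset (Fin (s * ℓ)))) | D ⊆ e} : ℝ) := by
    intro i D hD
    refine (h (eT i) (eT i).2 (D.image fun x => (eS x : V)) ?_ ?_).trans ?_
    · intro v hv
      obtain ⟨x, -, rfl⟩ := mem_image.1 hv
      exact (eS x).2
    · rw [card_image_of_injective _ hιinj, hD]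
    · rw [Nat.cast_le]
      refine card_le_card_of_surjOn (fun e => e.image fun x => (eS x : V)) ?_
      intro e he
      simp only [edgesBetween, coe_filter, Set.mem_ofPred_eq] at he
      obtain ⟨he, hDe, heS⟩ := he
      have hpre : (univ.filter fun x => (eS x : V) ∈ e).image (fun x => (eS x : V)) = e := by
        ext v
        simp only [mem_image, mem_filter, mem_univ, true_and]
        constructor
        · rintro ⟨x, hx, rfl⟩; exact hx
        · intro hv
          exact ⟨eS.symm ⟨v, heS hv⟩, by simpa using hv, by simp⟩
      refine ⟨univ.filter fun x => (eS x : V) ∈ e, ?_, hpre⟩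
      simp only [coe_filter, Set.mem_ofPred_eq, mem_filter, mem_univ, true_and]
      refine ⟨by rwa [hpre], fun x hx => ?_⟩
      simpa using hDe (mem_image_of_mem _ hx)
  obtain ⟨φ, hφ, hφ', c, hc, hedge⟩ := hfac _ hcard hdeg
  let f : Fin t → {e // e ∈ univ.image fF} := fun j => ⟨fF j, mem_image_of_mem _ (mem_univ j)⟩
  have hf : Function.Injective f := fun j j' hjj => hfF (congrArg Subtype.val hjj)
  refine ⟨fun x => eS (φ (eM x.2) x.1), fun x => eT (c (eM x.2, f x.1)), ?_, ?_,
    fun x => (eS _).2, fun x => (eT _).2, fun m j => ?_⟩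
  · rintro ⟨v, m⟩ ⟨v', m'⟩ hx
    have hx := hιinj hx
    simp only at hx
    have hm : eM m = eM m' := by
      by_contra hne
      exact hφ' _ _ hne _ _ hx
    rw [hm] at hx
    rw [hφ _ hx, eM.injective hm]
  · rintro ⟨j, m⟩ ⟨j', m'⟩ hx
    have hx := hc.1 (eT.injective (Subtype.val_injective hx))
    simp only [Prod.mk.injEq] at hx
    rw [eM.injective hx.1, hf hx.2]
  · have := hedge (eM m) (f j)
    rw [mem_filter, image_image] at this
    exact this.2

/-- The indices can be split into clusters of bounded size. -/
lemma exists_clustering {n L : ℕ} (hL : 0 < L) (hn : L ≤ n) : ∃ (J : Type) (c : Fin n → J),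
    ∀ j, L ≤ #{m | c m = j} ∧ #{m | c m = j} ≤ 2 * L := by
  have hq : 0 < n / L := Nat.div_pos hn hL
  have hqL : n / L * L ≤ n := Nat.div_mul_le_self n L
  have hnq : n < (n / L + 1) * L := by rw [mul_comm]; exact Nat.lt_mul_div_succ n hL
  refine ⟨Fin (n / L), fun m => ⟨min (m / L) (n / L - 1), by omega⟩, fun j => ⟨?_, ?_⟩⟩
  · have hj : (j + 1 : ℕ) * L ≤ n := (Nat.mul_le_mul_right L j.2).trans hqL
    have hlt : ∀ i : Fin L, j * L + i < n := fun i => by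
      have := i.2
      rw [add_mul] at hj
      omega
    calc L = #(univ : Finset (Fin L)) := by simp
      _ ≤ _ := by
        refine card_le_card_of_injOn (fun i => ⟨j * L + i, hlt i⟩) ?_ ?_
        · intro i _
          simp only [coe_filter, mem_univ, true_and, Set.mem_ofPred_eq, Fin.ext_iff]
          rw [add_comm, Nat.add_mul_div_right _ _ hL, Nat.div_eq_of_lt i.2]
          have := j.2
          omega
        · intro i _ i' _ h
          simp only [Fin.mk.injEq] at h
          exact Fin.ext (by omega)
  · calc _ ≤ #(range (2 * L)) := by
          have key : ∀ m : Fin n, min (m / L : ℕ) (n / L - 1) = j →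
              j * L ≤ m ∧ (m : ℕ) < j * L + 2 * L := by
            intro m hm
            have h1 : (m / L : ℕ) * L ≤ m := Nat.div_mul_le_self m L
            have h2 : (m : ℕ) < (m / L + 1) * L := by
              rw [mul_comm]; exact Nat.lt_mul_div_succ m hL
            have h3 : (j : ℕ) * L ≤ (m / L : ℕ) * L := Nat.mul_le_mul_right L (by omega)
            refine ⟨h3.trans h1, ?_⟩
            rw [← add_mul]
            rcases le_total (m / L : ℕ) (n / L - 1) with h | h
            · refine h2.trans_le (Nat.mul_le_mul_right L (by omega))
            · refine (m.2.trans hnq).trans_le (Nat.mul_le_mul_right L (by omega))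
          refine card_le_card_of_injOn (fun m => m - j * L) ?_ ?_
          · intro m hm
            simp only [coe_filter, mem_univ, true_and, Set.mem_ofPred_eq, Fin.ext_iff] at hm
            have := key m hm
            simp only [coe_range, Set.mem_Iio]
            omega
          · intro m hm m' hm' h
            simp only [coe_filter, mem_univ, true_and, Set.mem_ofPred_eq, Fin.ext_iff] at hm hm'
            have := key m hm
            have := key m' hm'
            simp only at h
            exact Fin.ext (by omega)
      _ = _ := card_range _

end Factors

section Spread

open Finset Equiv
open scoped Classical

lemma IsVertexSpread.mono {V W : Type*} [Fintype V] [Fintype W] [DecidableEq V] [DecidableEq W]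
    {q q' : ℝ} {μ : (V → W) → ℝ} (h : IsVertexSpread q μ) (hq : 0 ≤ q) (hqq' : q ≤ q') :
    IsVertexSpread q' μ :=
  fun s x y hx hy => (h s x y hx hy).trans (pow_le_pow_left₀ hq hqq' s)

/-- A spread family of group elements induces a spread distribution on maps that agree with the
elements up to rearrangement within small clusters. -/
lemma exists_isVertexSpread {G X Y J : Type*} [Group G] [Fintype X] [Fintype Y]
    [DecidableEq X] [DecidableEq Y] {ρ : G →* Perm Y} {𝓖 : Finset G} (h𝓖 : 𝓖.Nonempty)
    {Φ : G → X → Y} {cX : X → J} {cY : Y → J} {K : ℕ} {q : ℝ} (hq : 0 ≤ q)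
    (hK : ∀ j, #{y | cY y = j} ≤ K)
    (hΦ : ∀ g ∈ 𝓖, ∀ x, ∃ z, cY z = cX x ∧ ρ g z = Φ g x)
    (hspread : ∀ A : Finset (Y × Y), Set.InjOn Prod.fst (A : Set (Y × Y)) →
      (#{g ∈ 𝓖 | Realizes ρ A g} : ℝ) ≤ q ^ #A * #𝓖) :
    ∃ μ : (X → Y) → ℝ, (∀ φ, 0 ≤ μ φ) ∧ ∑ φ, μ φ = 1 ∧
      (∀ φ, μ φ ≠ 0 → ∃ g ∈ 𝓖, Φ g = φ) ∧ IsVertexSpread (K * q) μ := by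
  have hpos : (0 : ℝ) < #𝓖 := by exact_mod_cast h𝓖.card_pos
  refine ⟨fun φ => #{g ∈ 𝓖 | Φ g = φ} / #𝓖, fun φ => by positivity, ?_, fun φ hφ => ?_, ?_⟩
  · rw [← sum_div, div_eq_one_iff_eq hpos.ne', ← Nat.cast_sum, Nat.cast_inj]
    exact (card_eq_sum_card_fiberwise fun g _ => mem_univ (Φ g)).symm
  · have : #{g ∈ 𝓖 | Φ g = φ} ≠ 0 := by
      intro h
      exact hφ (by simp only [h, Nat.cast_zero, zero_div])
    obtain ⟨g, hg⟩ := card_ne_zero.1 this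
    exact ⟨g, mem_filter.1 hg⟩
  · intro s' x y hx hy
    rw [← sum_div, div_le_iff₀ hpos]
    have h1 : ∑ φ : X → Y with ∀ i, φ (x i) = y i, #{g ∈ 𝓖 | Φ g = φ} ≤
        #{g ∈ 𝓖 | ∀ i, Φ g (x i) = y i} := by
      rw [card_eq_sum_card_fiberwise (f := Φ) (t := {φ : X → Y | ∀ i, φ (x i) = y i})]
      · refine sum_le_sum fun φ hφ => card_le_card fun g hg => ?_
        rw [mem_filter] at hg hφ
        rw [mem_filter, mem_filter]
        exact ⟨⟨hg.1, fun i => hg.2 ▸ hφ.2 i⟩, hg.2⟩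
      · intro g hg
        simpa using (mem_filter.1 hg).2
    let A : (Fin s' → Y) → Finset (Y × Y) := fun z => univ.image fun i => (z i, y i)
    have hA : ∀ z, #(A z) = s' := fun z => by
      rw [card_image_of_injective _ fun i i' h => hy (Prod.mk.inj h).2, card_univ,
        Fintype.card_fin]
    have hAspread : ∀ z, (#{g ∈ 𝓖 | Realizes ρ (A z) g} : ℝ) ≤ q ^ s' * #𝓖 := by
      intro z
      rcases eq_empty_or_nonempty {g ∈ 𝓖 | Realizes ρ (A z) g} with h | ⟨g, hg⟩
      · rw [h, card_empty, Nat.cast_zero]; positivity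
      · rw [← hA z]
        refine hspread _ ?_
        have hg := (mem_filter.1 hg).2
        intro p hp p' hp' hpp
        refine Prod.ext hpp ?_
        rw [← hg p hp, ← hg p' hp', hpp]
    have h2 : ({g ∈ 𝓖 | ∀ i, Φ g (x i) = y i} : Finset G) ⊆
        (Fintype.piFinset fun i => ({z | cY z = cX (x i)} : Finset Y)).biUnion
          fun z => ({g ∈ 𝓖 | Realizes ρ (A z) g} : Finset G) := by
      intro g hg
      obtain ⟨hg, hgy⟩ := mem_filter.1 hg
      choose z hz hzΦ using fun i => hΦ g hg (x i)
      simp only [mem_biUnion, Fintype.mem_piFinset, mem_filter, mem_univ, true_and]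
      refine ⟨z, hz, hg, fun p hp => ?_⟩
      obtain ⟨i, -, rfl⟩ := mem_image.1 hp
      exact (hzΦ i).trans (hgy i)
    have h3 : #(Fintype.piFinset fun i => ({z | cY z = cX (x i)} : Finset Y)) ≤ K ^ s' := by
      rw [Fintype.card_piFinset]
      refine (prod_le_prod' fun i _ => hK _).trans ?_
      simp
    calc _ ≤ (#{g ∈ 𝓖 | ∀ i, Φ g (x i) = y i} : ℝ) := by
          rw [← Nat.cast_sum]
          convert (Nat.cast_le (α := ℝ)).2 h1
      _ ≤ ∑ z ∈ Fintype.piFinset fun i => ({z | cY z = cX (x i)} : Finset Y),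
            (#{g ∈ 𝓖 | Realizes ρ (A z) g} : ℝ) := by
          exact_mod_cast (card_le_card h2).trans card_biUnion_le
      _ ≤ ∑ z ∈ Fintype.piFinset fun i => ({z | cY z = cX (x i)} : Finset Y),
            q ^ s' * #𝓖 := sum_le_sum fun z _ => hAspread z
      _ ≤ K ^ s' * (q ^ s' * #𝓖) := by
          rw [sum_const, nsmul_eq_mul]
          gcongr
          exact_mod_cast h3
      _ = _ := by rw [mul_pow, mul_assoc]

/-- Factors of the clusters combine to a factor. -/
lemma exists_isExpansionFactorEmbedding {s t n : ℕ} {J : Type*} {fF : Fin t → Finset (Fin s)}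
    {Hs : Fin (t * n) → Finset (Finset (Fin (s * n)))} {c : Fin n → J}
    {S : J → Finset (Fin (s * n))} {T : J → Finset (Fin (t * n))}
    (hS : Pairwise fun j j' => Disjoint (S j) (S j'))
    (hT : Pairwise fun j j' => Disjoint (T j) (T j'))
    (h : ∀ j, ∃ (a : Fin s × {m // c m = j} → Fin (s * n))
      (b : Fin t × {m // c m = j} → Fin (t * n)), a.Injective ∧ b.Injective ∧ (∀ x, a x ∈ S j) ∧
      (∀ x, b x ∈ T j) ∧ ∀ m i, (fF i).image (fun v => a (v, m)) ∈ Hs (b (i, m))) :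
    ∃ φ : (Fin s ⊕ Fin t) × Fin n → Fin (s * n) ⊕ Fin (t * n),
      IsExpansionFactorEmbedding fF Hs φ ∧
      (∀ v m, ∃ x ∈ S (c m), φ (Sum.inl v, m) = Sum.inl x) ∧
      ∀ i m, ∃ x ∈ T (c m), φ (Sum.inr i, m) = Sum.inr x := by
  choose a b ha hb haS hbT hab using h
  have ha' : ∀ {j j'} (x : Fin s × {m // c m = j}) (x' : Fin s × {m // c m = j'}),
      a j x = a j' x' → x.1 = x'.1 ∧ x.2.1 = x'.2.1 := by
    intro j j' x x' hx
    have hj : j = j' := by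
      by_contra hne
      exact disjoint_left.1 (hS hne) (haS j x) (hx ▸ haS j' x')
    subst hj
    rw [ha j hx]
    exact ⟨rfl, rfl⟩
  have hb' : ∀ {j j'} (x : Fin t × {m // c m = j}) (x' : Fin t × {m // c m = j'}),
      b j x = b j' x' → x.1 = x'.1 ∧ x.2.1 = x'.2.1 := by
    intro j j' x x' hx
    have hj : j = j' := by
      by_contra hne
      exact disjoint_left.1 (hT hne) (hbT j x) (hx ▸ hbT j' x')
    subst hj
    rw [hb j hx]
    exact ⟨rfl, rfl⟩
  refine ⟨fun x => Sum.map (fun v => a (c x.2) (v, ⟨x.2, rfl⟩)) (fun i => b (c x.2) (i, ⟨x.2, rfl⟩))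
    x.1, ⟨?_, fun m i => ?_⟩, fun v m => ⟨_, haS _ _, rfl⟩, fun i m => ⟨_, hbT _ _, rfl⟩⟩
  · rintro ⟨v | i, m⟩ ⟨v' | i', m'⟩ hx
    · obtain ⟨h₁, h₂⟩ := ha' _ _ (Sum.inl_injective hx)
      exact Prod.ext (congrArg Sum.inl h₁) h₂
    · simp at hx
    · simp at hx
    · obtain ⟨h₁, h₂⟩ := hb' _ _ (Sum.inr_injective hx)
      exact Prod.ext (congrArg Sum.inr h₁) h₂
  · refine ⟨b (c m) (i, ⟨m, rfl⟩), _, hab _ ⟨m, rfl⟩ i, ?_⟩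
    rw [image_image]
    rfl

end Spread

section Main

open Finset Equiv Filter
open scoped Classical

lemma eventually_mul_pow_mul_exp_le_one (c d : ℕ) {γ : ℝ} (hγ : 0 < γ) :
    ∀ᶠ L : ℕ in atTop, 8 * ((c * L : ℕ) : ℝ) * (((c * L : ℕ) : ℝ) ^ (d + 1) *
      (2 * Real.exp (-(γ * ((L - (d + 1) : ℕ) : ℝ))))) ≤ 1 := by
  have h1 := tendsto_pow_const_mul_const_pow_of_abs_lt_one (d + 2) (r := Real.exp (-γ)) (by
    rw [abs_of_pos (Real.exp_pos _), Real.exp_lt_one_iff]; linarith)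
  have h2 := h1.const_mul (16 * (c : ℝ) ^ (d + 2) * Real.exp (γ * (d + 1)))
  rw [mul_zero] at h2
  filter_upwards [h2.eventually (ge_mem_nhds one_pos), eventually_ge_atTop (d + 1)] with L hL hLd
  refine le_trans (le_of_eq ?_) hL
  have h3 : Real.exp (-(γ * ((L - (d + 1) : ℕ) : ℝ))) =
      Real.exp (γ * (d + 1)) * Real.exp (-γ) ^ L := by
    rw [← Real.exp_nat_mul, ← Real.exp_add, Nat.cast_sub hLd]
    congr 1
    push_cast
    ring
  rw [h3]
  push_cast
  ring

lemma card_image_perm {V : Type*} (σ : Perm V) (S : Finset V) : #(S.image σ) = #S :=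
  card_image_of_injective _ σ.injective

lemma card_filter_finProdFinEquiv {s n : ℕ} {J : Type*} (c : Fin n → J) (j : J) :
    #{v : Fin (s * n) | c (finProdFinEquiv.symm v).2 = j} = s * #{m | c m = j} := by
  calc _ = #((univ : Finset (Fin s)) ×ˢ ({m | c m = j} : Finset (Fin n))) :=
        card_equiv finProdFinEquiv.symm (by simp)
    _ = _ := by rw [card_product, card_univ, Fintype.card_fin]

lemma card_filter_sumElim_finProdFinEquiv {s t n : ℕ} {J : Type*} (c : Fin n → J) (j : J) :
    #{y | Sum.elim (fun v : Fin (s * n) => c (finProdFinEquiv.symm v).2)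
      (fun w : Fin (t * n) => c (finProdFinEquiv.symm w).2) y = j} =
      (s + t) * #{m | c m = j} := by
  rw [add_mul, ← card_filter_finProdFinEquiv, ← card_filter_finProdFinEquiv, ← card_disjSum]
  congr 1
  ext (v | w) <;> simp

lemma card_realizes_le_pow_mul {V W : Type*} [Fintype V] [Fintype W]
    {𝓖 : Finset (Perm V × Perm W)} {A : Finset ((V ⊕ W) × (V ⊕ W))} {n : ℕ} (hn : 0 < n)
    (hV : n ≤ Fintype.card V) (hW : n ≤ Fintype.card W)
    (h : #{g ∈ 𝓖 | Realizes (Perm.sumCongrHom V W) A g} * Fintype.card (Perm V × Perm W) ≤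
      2 ^ #A * #(realizers (Perm.sumCongrHom V W) A) * #𝓖)
    (hA : Set.InjOn Prod.fst (A : Set ((V ⊕ W) × (V ⊕ W)))) :
    (#{g ∈ 𝓖 | Realizes (Perm.sumCongrHom V W) A g} : ℝ) ≤ (2 * Real.exp 1 / n) ^ #A * #𝓖 := by
  have h1 := realizers_sumCongrHom_card_mul_le A hA (Nat.cast_nonneg n)
    (by exact_mod_cast hV) (by exact_mod_cast hW)
  have hG : (0 : ℝ) < Fintype.card (Perm V × Perm W) := by exact_mod_cast Fintype.card_pos
  have hn' : (0 : ℝ) < (n : ℝ) ^ #A := by positivity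
  have h2 : (#{g ∈ 𝓖 | Realizes (Perm.sumCongrHom V W) A g} : ℝ) *
      Fintype.card (Perm V × Perm W) ≤
        2 ^ #A * #(realizers (Perm.sumCongrHom V W) A) * #𝓖 := by exact_mod_cast h
  rw [div_pow, div_mul_eq_mul_div, le_div_iff₀ hn']
  refine le_of_mul_le_mul_right ?_ hG
  calc _ = (#{g ∈ 𝓖 | Realizes (Perm.sumCongrHom V W) A g} : ℝ) *
        Fintype.card (Perm V × Perm W) * n ^ #A := by ring
    _ ≤ 2 ^ #A * #(realizers (Perm.sumCongrHom V W) A) * #𝓖 * n ^ #A := by gcongr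
    _ = 2 ^ #A * #𝓖 * (#(realizers (Perm.sumCongrHom V W) A) * n ^ #A) := by ring
    _ ≤ 2 ^ #A * #𝓖 * (Real.exp 1 ^ #A * Fintype.card (Perm V × Perm W)) := by gcongr
    _ = _ := by rw [mul_pow]; ring

/-- Good clusters yield a vertex-spread distribution on factors. -/
lemma exists_isVertexSpread_of_isGoodPair {s t n K : ℕ} {J : Type*} {fF : Fin t → Finset (Fin s)}
    {Hs : Fin (t * n) → Finset (Finset (Fin (s * n)))} {c : Fin n → J} (hn : 0 < n)
    (hs : 0 < s)
    (hK : ∀ j, #{y | Sum.elim (fun v : Fin (s * n) => c (finProdFinEquiv.symm v).2)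
      (fun w : Fin (t * n) => c (finProdFinEquiv.symm w).2) y = j} ≤ K)
    {𝓖 : Finset (Perm (Fin (s * n)) × Perm (Fin (t * n)))} (h𝓖 : 𝓖.Nonempty)
    {p : ℝ} (hp : 0 ≤ p)
    (hspread : ∀ A : Finset ((Fin (s * n) ⊕ Fin (t * n)) × (Fin (s * n) ⊕ Fin (t * n))),
      Set.InjOn Prod.fst (A : Set ((Fin (s * n) ⊕ Fin (t * n)) × (Fin (s * n) ⊕ Fin (t * n)))) →
      (#{g ∈ 𝓖 | Realizes (Perm.sumCongrHom _ _) A g} : ℝ) ≤ p ^ #A * #𝓖)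
    (h : ∀ g ∈ 𝓖, ∀ j, ∃ (a : Fin s × {m // c m = j} → Fin (s * n))
      (b : Fin t × {m // c m = j} → Fin (t * n)), a.Injective ∧ b.Injective ∧
      (∀ x, a x ∈ ({v | c (finProdFinEquiv.symm v).2 = j} : Finset (Fin (s * n))).image g.1) ∧
      (∀ x, b x ∈ ({w | c (finProdFinEquiv.symm w).2 = j} : Finset (Fin (t * n))).image g.2) ∧
      ∀ m i, (fF i).image (fun v => a (v, m)) ∈ Hs (b (i, m))) :
    ∃ μ : ((Fin s ⊕ Fin t) × Fin n → Fin (s * n) ⊕ Fin (t * n)) → ℝ,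
      (∀ φ, 0 ≤ μ φ) ∧ (∑ φ, μ φ = 1) ∧
      (∀ φ, μ φ ≠ 0 → IsExpansionFactorEmbedding fF Hs φ) ∧
      IsVertexSpread (K * p) μ := by
  have hdisj : ∀ {N : ℕ} (cl : Fin N → J) (σ : Perm (Fin N)), Pairwise fun j j' =>
      Disjoint (({v | cl v = j} : Finset (Fin N)).image σ)
        (({v | cl v = j'} : Finset (Fin N)).image σ) := by
    intro N cl σ j j' hne
    rw [disjoint_left]
    intro v hv hv'
    obtain ⟨x, hx, rfl⟩ := mem_image.1 hv
    obtain ⟨x', hx', hxx⟩ := mem_image.1 hv'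
    rw [σ.injective hxx] at hx'
    exact hne ((mem_filter.1 hx).2.symm.trans (mem_filter.1 hx').2)
  have hΦ : ∀ g, ∃ φ : (Fin s ⊕ Fin t) × Fin n → Fin (s * n) ⊕ Fin (t * n), g ∈ 𝓖 →
      IsExpansionFactorEmbedding fF Hs φ ∧
      ∀ x, ∃ z, Sum.elim (fun v : Fin (s * n) => c (finProdFinEquiv.symm v).2)
        (fun w : Fin (t * n) => c (finProdFinEquiv.symm w).2) z = c x.2 ∧
        Perm.sumCongrHom _ _ g z = φ x := by
    intro g
    by_cases hg : g ∈ 𝓖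
    · obtain ⟨φ, hφ, hφV, hφW⟩ :=
        exists_isExpansionFactorEmbedding (hdisj _ g.1) (hdisj _ g.2) (h g hg)
      refine ⟨φ, fun _ => ⟨hφ, ?_⟩⟩
      rintro ⟨v | i, m⟩
      · obtain ⟨x, hx, hx'⟩ := hφV v m
        obtain ⟨z, hz, rfl⟩ := mem_image.1 hx
        exact ⟨Sum.inl z, (mem_filter.1 hz).2, hx'.symm⟩
      · obtain ⟨x, hx, hx'⟩ := hφW i m
        obtain ⟨z, hz, rfl⟩ := mem_image.1 hx
        exact ⟨Sum.inr z, (mem_filter.1 hz).2, hx'.symm⟩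
    · exact ⟨fun _ => Sum.inl ⟨0, Nat.mul_pos hs hn⟩, fun h => absurd h hg⟩
  choose Φ hΦ using hΦ
  obtain ⟨μ, hμ₀, hμ₁, hμ, hμs⟩ := exists_isVertexSpread h𝓖 hp hK (fun g hg => (hΦ g hg).2) hspread
  refine ⟨μ, hμ₀, hμ₁, fun φ hφ => ?_, hμs⟩
  obtain ⟨g, hg, rfl⟩ := hμ φ hφ
  exact (hΦ g hg).1

/-- The main theorem for a fixed `k`-graph and a fixed `d`. -/
lemma exists_isVertexSpread_of_degree {α : ℝ} (hα : 0 < α) {k s t d : ℕ} (hs : 0 < s) (ht : 0 < t)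
    (hdk : d < k) {fF : Fin t → Finset (Fin s)} (hfF : Function.Injective fF) :
    ∃ C : ℝ, 0 < C ∧ ∃ n₀ : ℕ, ∀ n : ℕ, n₀ ≤ n →
      ∀ Hs : Fin (t * n) → Finset (Finset (Fin (s * n))), (∀ i, ∀ e ∈ Hs i, #e = k) →
        (∀ i (D : Finset (Fin (s * n))), #D = d →
          (transversalDiracThreshold k s t d (univ.image fF) + α) *
              ((s * n - d).choose (k - d) : ℝ) ≤ (#{e ∈ Hs i | D ⊆ e} : ℝ)) →
      ∃ μ : ((Fin s ⊕ Fin t) × Fin n → Fin (s * n) ⊕ Fin (t * n)) → ℝ,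
        (∀ φ, 0 ≤ μ φ) ∧ (∑ φ, μ φ = 1) ∧
        (∀ φ, μ φ ≠ 0 → IsExpansionFactorEmbedding fF Hs φ) ∧ IsVertexSpread (C / n) μ := by
  set δ := transversalDiracThreshold k s t d (univ.image fF) with hδ
  have hδ₀ : 0 ≤ δ := transversalDiracThreshold_nonneg _ _ _ _ _
  have hr : 0 < k - d := by omega
  obtain ⟨n₁, hn₁⟩ := exists_forall_isTransversalFFactor hs ht hdk.le (univ.image fF)
    (half_pos hα)
  obtain ⟨m₀, hm₀⟩ := exists_card_apply_eq_edgesBetween_lt d hr hδ₀ hα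
  choose! N₀ hN₀ using hm₀
  have hγ : 0 < (α / 8) ^ 2 / (2 * ((k - d : ℕ) : ℝ) ^ 2) := by positivity
  obtain ⟨L, hexp, hL₁, hLm, hLpos⟩ :=
    ((eventually_mul_pow_mul_exp_le_one ((s + t) * 2) d hγ).and
      ((eventually_ge_atTop n₁).and ((eventually_ge_atTop m₀).and (eventually_gt_atTop 0)))).exists
  set K := (s + t) * 2 * L with hK
  have hKpos : 0 < K := by positivity
  refine ⟨K * (2 * Real.exp 1), by positivity,
    L + (range (2 * L + 1)).sup (fun ℓ => N₀ (s * ℓ)), fun n hn Hs hHs hdeg => ?_⟩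
  obtain ⟨q, c, hc⟩ := exists_clustering hLpos ((Nat.le_add_right _ _).trans hn)
  have hcl : ∀ j, #{y | Sum.elim (fun v : Fin (s * n) => c (finProdFinEquiv.symm v).2)
      (fun w : Fin (t * n) => c (finProdFinEquiv.symm w).2) y = j} ≤ K := by
    intro j
    rw [card_filter_sumElim_finProdFinEquiv, hK, mul_assoc]
    exact Nat.mul_le_mul_left _ (hc j).2
  have hsize : ∀ j, L ≤ s * #{m | c m = j} := fun j =>
    (hc j).1.trans (Nat.le_mul_of_pos_left _ hs)
  have hne : ∀ j, ∃ x : Fin (s * n), c (finProdFinEquiv.symm x).2 = j := by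
    intro j
    obtain ⟨x, hx⟩ := card_pos.1 (hLpos.trans_le
      ((hsize j).trans_eq (card_filter_finProdFinEquiv (s := s) c j).symm))
    exact ⟨x, (mem_filter.1 hx).2⟩
  have hdev : ∀ (w : Fin (t * n)) (x y : Fin (s * n)), ∀ D₀ ⊆ ({v : Fin (s * n) |
      c (finProdFinEquiv.symm v).2 = c (finProdFinEquiv.symm x).2} : Finset _), #D₀ = d → _ :=
    fun w x y D₀ hD₀ hD => hN₀ _ (hLm.trans (hsize (c (finProdFinEquiv.symm x).2))) (Fin (s * n))
      (by
        rw [Fintype.card_fin]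
        refine le_trans ?_ (((Nat.le_add_left _ _).trans hn).trans (Nat.le_mul_of_pos_left _ hs))
        exact le_sup (f := fun ℓ => N₀ (s * ℓ)) (mem_range.2 (Nat.lt_succ_of_le (hc _).2)))
      (Hs w) (fun e he => by rw [hHs w e he]; omega)
      (fun D hD => by convert hdeg w D hD; exact Fintype.card_fin _) D₀ _ x y hD₀ (by simp) hD
      (card_filter_finProdFinEquiv c _)
  have hβ : ∀ j, 2 * Real.exp (-((α / 8) ^ 2 * ((s * #{m | c m = j} - (d + 1) : ℕ) : ℝ) /
      (2 * ((k - d : ℕ) : ℝ) ^ 2))) ≤ 2 * Real.exp (-((α / 8) ^ 2 /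
        (2 * ((k - d : ℕ) : ℝ) ^ 2) * ((L - (d + 1) : ℕ) : ℝ))) := by
    intro j
    rw [← mul_div_right_comm]
    gcongr
    exact hsize j
  obtain ⟨𝓖, h𝓖, hgood, hspread⟩ := exists_family_isGoodPair (Hs := Hs) (d := d)
    (θ := fun j => (δ + α / 2) * ((s * #{m | c m = j} - d).choose (k - d) : ℕ))
    (clW := fun w : Fin (t * n) => c (finProdFinEquiv.symm w).2) hne hKpos hcl (by positivity)
    hexp fun w x y D₀ hD₀ hD => (hdev w x y D₀ hD₀ hD).trans
      (mul_le_mul_of_nonneg_right (hβ _) (Nat.cast_nonneg _))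
  have hn₀ : 0 < n := by omega
  rw [mul_div_assoc]
  refine exists_isVertexSpread_of_isGoodPair hn₀ hs hcl h𝓖 (by positivity)
    (fun A => card_realizes_le_pow_mul hn₀ (by simpa using Nat.le_mul_of_pos_left n hs)
      (by simpa using Nat.le_mul_of_pos_left n ht) (hspread A)) fun g hg j => ?_
  have hfac : _ := (hgood g hg j).exists_factor hfF (ℓ := #{m | c m = j})
    (fun Hs' hHs' hdeg' => hn₁ _ (hL₁.trans (hc j).1) Hs' hHs' fun i D hD => hdeg' i D hD) hHs
    ((card_image_perm _ _).trans (card_filter_finProdFinEquiv c j))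
    ((card_image_perm _ _).trans (card_filter_finProdFinEquiv c j))
    (M := {m // c m = j}) (Fintype.card_subtype _)
  convert hfac

end Main

theorem vertex_spread_expansion_factor
    (α : ℝ) (hα : 0 < α) (k s t : ℕ) (hk : 0 < k) (hs : 2 ≤ s) (ht : 0 < t) :
    ∃ C : ℝ, 0 < C ∧
      ∀ d : ℕ, 1 ≤ d → d ≤ k - 1 →
      ∃ n₀ : ℕ, ∀ n : ℕ, n₀ ≤ n →
      ∀ fF : Fin t → Finset (Fin s), Function.Injective fF → (∀ j, (fF j).card = k) →
      ∀ Hs : Fin (t * n) → Finset (Finset (Fin (s * n))),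
        (∀ i, ∀ e ∈ Hs i, e.card = k) →
        (∀ i (D : Finset (Fin (s * n))), D.card = d →
          (transversalDiracThreshold k s t d (Finset.univ.image fF) + α) *
              ((s * n - d).choose (k - d) : ℝ) ≤
            (((Hs i).filter fun e => D ⊆ e).card : ℝ)) →
      ∃ μ : ((Fin s ⊕ Fin t) × Fin n → Fin (s * n) ⊕ Fin (t * n)) → ℝ,
        (∀ φ, 0 ≤ μ φ) ∧ (∑ φ, μ φ = 1) ∧
        (∀ φ, μ φ ≠ 0 → IsExpansionFactorEmbedding fF Hs φ) ∧
        IsVertexSpread (C / n) μ := by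
  have key : ∀ (d : ℕ) (fF : Fin t → Finset (Fin s)), ∃ C : ℝ, 0 < C ∧ ∃ n₀ : ℕ, d < k →
      Function.Injective fF → ∀ n : ℕ, n₀ ≤ n →
      ∀ Hs : Fin (t * n) → Finset (Finset (Fin (s * n))),
        (∀ i, ∀ e ∈ Hs i, e.card = k) →
        (∀ i (D : Finset (Fin (s * n))), D.card = d →
          (transversalDiracThreshold k s t d (Finset.univ.image fF) + α) *
              ((s * n - d).choose (k - d) : ℝ) ≤
            (((Hs i).filter fun e => D ⊆ e).card : ℝ)) →
      ∃ μ : ((Fin s ⊕ Fin t) × Fin n → Fin (s * n) ⊕ Fin (t * n)) → ℝ,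
        (∀ φ, 0 ≤ μ φ) ∧ (∑ φ, μ φ = 1) ∧
        (∀ φ, μ φ ≠ 0 → IsExpansionFactorEmbedding fF Hs φ) ∧
        IsVertexSpread (C / n) μ := by
    intro d fF
    by_cases h : d < k ∧ Function.Injective fF
    · obtain ⟨C, hC, n₀, H⟩ := exists_isVertexSpread_of_degree hα (zero_lt_two.trans_le hs) ht
        h.1 h.2
      refine ⟨C, hC, n₀, fun _ _ n hn Hs hHs hdeg => ?_⟩
      convert H n hn Hs hHs fun i D hD => ?_
      convert hdeg i D hD
    · exact ⟨1, one_pos, 0, fun h₁ h₂ => absurd ⟨h₁, h₂⟩ h⟩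
  choose C hC n₀ H using key
  refine ⟨∑ d ∈ Finset.range k, ∑ fF, C d fF + 1,
    add_pos_of_nonneg_of_pos (Finset.sum_nonneg fun d _ => Finset.sum_nonneg fun fF _ =>
      (hC d fF).le) one_pos, fun d _ hd => ⟨Finset.univ.sup (n₀ d), ?_⟩⟩
  intro n hn fF hfF _ Hs hHs hdeg
  have hdk : d < k := by omega
  obtain ⟨μ, h₀, h₁, hemb, hspread⟩ := H d fF hdk hfF n
    ((Finset.le_sup (Finset.mem_univ fF)).trans hn) Hs hHs hdeg
  refine ⟨μ, h₀, h₁, hemb, hspread.mono (div_nonneg (hC d fF).le (Nat.cast_nonneg n)) ?_⟩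
  refine div_le_div_of_nonneg_right ?_ (Nat.cast_nonneg n)
  calc C d fF ≤ ∑ fF, C d fF :=
        Finset.single_le_sum (fun fF _ => (hC d fF).le) (Finset.mem_univ fF)
    _ ≤ ∑ d ∈ Finset.range k, ∑ fF, C d fF :=
        Finset.single_le_sum (f := fun d => ∑ fF, C d fF)
          (fun d _ => Finset.sum_nonneg fun fF _ => (hC d fF).le) (Finset.mem_range.2 hdk)
    _ ≤ _ := le_add_of_nonneg_right zero_le_one
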